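/- arXiv:2507.23584 — 5 statements merged into one kernel-verified Lean document; each statement's English description precedes it below -/
import Mathlib

section
/- Let γ : I → X be locally of bounded variation. Then there exists a unique Borel measure ν on I such that ν(J) = Var(γ;J) for every subinterval J ⊆ I that is open in the relative topology of I. -/
open Filter Topology Set MeasureTheory

/-- The order-convex hull of the image of `J` under `v`. -/
def imageHull (v : ℝ → ℝ) (J : Set ℝ) : Set ℝ :=
  {y | ∃ s ∈ J, ∃ t ∈ J, v s ≤ y ∧ y ≤ v t}

/-- The generalized inverse on the set `I` of a monotone function `v`. -/
noncomputable def monotoneInverse (v : ℝ → ℝ) (I : Set ℝ) (y : ℝ) : ℝ :=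
  sSup {t ∈ I | v t ≤ y}

lemma imageHull_mono (v : ℝ → ℝ) {J I : Set ℝ} (h : J ⊆ I) : imageHull v J ⊆ imageHull v I := by
  rintro y ⟨s, hs, t, ht, h1, h2⟩
  exact ⟨s, h hs, t, h ht, h1, h2⟩

lemma ordConnected_imageHull (v : ℝ → ℝ) (J : Set ℝ) : (imageHull v J).OrdConnected := by
  refine ⟨?_⟩
  rintro x ⟨s, hs, -, -, h1, -⟩ y ⟨-, -, t, ht, -, h2⟩ z hz
  exact ⟨s, hs, t, ht, h1.trans hz.1, hz.2.trans h2⟩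

lemma exists_lt_lt_of_mem_interior_imageHull {v : ℝ → ℝ} {J : Set ℝ} {y : ℝ}
    (hy : y ∈ interior (imageHull v J)) : ∃ s ∈ J, ∃ t ∈ J, v s < y ∧ y < v t := by
  have hn : imageHull v J ∈ 𝓝 y := mem_interior_iff_mem_nhds.1 hy
  obtain ⟨a, ⟨s, hs, -, -, h1, -⟩, ha⟩ :=
    Filter.nonempty_of_mem
    (inter_mem (mem_nhdsWithin_of_mem_nhds hn) (self_mem_nhdsWithin : Iio y ∈ 𝓝[<] y))
  obtain ⟨b, ⟨-, -, t, ht, -, h2⟩, hb⟩ :=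
    Filter.nonempty_of_mem
    (inter_mem (mem_nhdsWithin_of_mem_nhds hn) (self_mem_nhdsWithin : Ioi y ∈ 𝓝[>] y))
  exact ⟨s, hs, t, ht, h1.trans_lt ha, lt_of_lt_of_le hb h2⟩

lemma volume_interior_imageHull (v : ℝ → ℝ) (J : Set ℝ) :
    volume (interior (imageHull v J)) = volume (imageHull v J) :=
  measure_congr (interior_ae_eq_of_null_frontier
    ((ordConnected_imageHull v J).convex.addHaar_frontier _))

lemma volume_imageHull_eq_eVariationOn {X : Type*} [PseudoEMetricSpace X] {γ : ℝ → X}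
    {v : ℝ → ℝ} {J : Set ℝ} (hJ : J.OrdConnected) (hmono : MonotoneOn v J)
    (hv : ∀ a ∈ J, ∀ b ∈ J, a ≤ b → ENNReal.ofReal (v b - v a) = eVariationOn γ (Icc a b)) :
    volume (imageHull v J) = eVariationOn γ J := by
  apply le_antisymm
  · rw [(ordConnected_imageHull v J).measurableSet.measure_eq_iSup_isCompact]
    refine iSup₂_le fun K hK => iSup_le fun hKc => ?_
    rcases K.eq_empty_or_nonempty with rfl | hne
    · simp
    obtain ⟨s, hs, -, -, h1, -⟩ := hK (hKc.sInf_mem hne)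
    obtain ⟨-, -, t, ht, -, h2⟩ := hK (hKc.sSup_mem hne)
    have hsub : K ⊆ Icc (v s) (v t) := fun y hy =>
      ⟨h1.trans (csInf_le hKc.bddBelow hy), (le_csSup hKc.bddAbove hy).trans h2⟩
    refine (measure_mono hsub).trans ?_
    rw [Real.volume_Icc]
    rcases le_total s t with hst | hst
    · rw [hv s hs t ht hst]
      exact eVariationOn.mono γ (hJ.out hs ht)
    · simp [ENNReal.ofReal_of_nonpos (sub_nonpos.2 (hmono ht hs hst))]
  · rw [eVariationOn.eq_biSup_inter_Icc]
    refine iSup₂_le fun p hp => ?_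
    obtain ⟨h1, h2, h12⟩ := hp
    rw [inter_eq_self_of_subset_right (hJ.out h1 h2), ← hv _ h1 _ h2 h12, ← Real.volume_Icc]
    exact measure_mono fun y hy => ⟨_, h1, _, h2, hy.1, hy.2⟩

section MonotoneInverse

variable {v : ℝ → ℝ} {I : Set ℝ}

lemma le_monotoneInverse (hv : MonotoneOn v I) {y u : ℝ} (hy : y ∈ interior (imageHull v I))
    (hu : u ∈ I) (h : v u ≤ y) : u ≤ monotoneInverse v I y := by
  obtain ⟨-, -, t, ht, -, h2⟩ := exists_lt_lt_of_mem_interior_imageHull hy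
  refine le_csSup ⟨t, fun w hw => ?_⟩ ⟨hu, h⟩
  by_contra! hlt
  linarith [hv ht hw.1 hlt.le, hw.2]

lemma monotoneInverse_le (hv : MonotoneOn v I) {y u : ℝ} (hy : y ∈ interior (imageHull v I))
    (hu : u ∈ I) (h : y < v u) : monotoneInverse v I y ≤ u := by
  obtain ⟨s, hs, -, -, h1, -⟩ := exists_lt_lt_of_mem_interior_imageHull hy
  refine csSup_le ⟨s, hs, h1.le⟩ fun w hw => ?_
  by_contra! hlt
  linarith [hv hu hw.1 hlt.le, hw.2]

lemma monotoneInverse_mem (hv : MonotoneOn v I) {J : Set ℝ} (hJI : J ⊆ I) (hJ : J.OrdConnected)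
    {y : ℝ} (hy : y ∈ interior (imageHull v J)) : monotoneInverse v I y ∈ J := by
  obtain ⟨s, hs, t, ht, h1, h2⟩ := exists_lt_lt_of_mem_interior_imageHull hy
  have hyI := interior_mono (imageHull_mono v hJI) hy
  exact hJ.out hs ht ⟨le_monotoneInverse hv hyI (hJI hs) h1.le,
    monotoneInverse_le hv hyI (hJI ht) h2⟩

lemma monotoneOn_monotoneInverse (hv : MonotoneOn v I) :
    MonotoneOn (monotoneInverse v I) (interior (imageHull v I)) := by
  intro x hx y hy hxy
  obtain ⟨s, hs, -, -, h1, -⟩ := exists_lt_lt_of_mem_interior_imageHull hx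
  exact csSup_le ⟨s, hs, h1.le⟩ fun w hw => le_monotoneInverse hv hy hw.1 (hw.2.trans hxy)

lemma mem_imageHull_of_monotoneInverse_mem (hv : MonotoneOn v I) (hI : I.OrdConnected)
    {U : Set ℝ} (hU : IsOpen U) {y : ℝ} (hy : y ∈ interior (imageHull v I))
    (h : monotoneInverse v I y ∈ U ∩ I) : y ∈ imageHull v (U ∩ I) := by
  obtain ⟨s, hs, t, ht, h1, h2⟩ := exists_lt_lt_of_mem_interior_imageHull hy
  set p := monotoneInverse v I y with hp
  have hUp : U ∈ 𝓝 p := hU.mem_nhds h.1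
  have hlow : ∃ a ∈ U ∩ I, v a ≤ y := by
    rcases (le_monotoneInverse hv hy hs h1.le).lt_or_eq with hlt | heq
    · obtain ⟨a, haU, ha⟩ := Filter.nonempty_of_mem
        (inter_mem (mem_nhdsWithin_of_mem_nhds hUp) (Ioo_mem_nhdsLT hlt))
      have haI : a ∈ I := hI.out hs h.2 (Ioo_subset_Icc_self ha)
      refine ⟨a, ⟨haU, haI⟩, ?_⟩
      by_contra! hlt'
      exact absurd (monotoneInverse_le hv hy haI hlt') (not_le.2 ha.2)
    · exact ⟨p, h, by rw [hp, ← heq]; exact h1.le⟩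
  have hupp : ∃ b ∈ U ∩ I, y ≤ v b := by
    rcases (monotoneInverse_le hv hy ht h2).lt_or_eq with hlt | heq
    · obtain ⟨b, hbU, hb⟩ := Filter.nonempty_of_mem
        (inter_mem (mem_nhdsWithin_of_mem_nhds hUp) (Ioo_mem_nhdsGT hlt))
      have hbI : b ∈ I := hI.out h.2 ht (Ioo_subset_Icc_self hb)
      refine ⟨b, ⟨hbU, hbI⟩, ?_⟩
      by_contra! hlt'
      exact absurd (le_monotoneInverse hv hy hbI hlt'.le) (not_le.2 hb.1)
    · exact ⟨p, h, by rw [hp, heq]; exact h2.le⟩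
  obtain ⟨a, ha, hay⟩ := hlow
  obtain ⟨b, hb, hyb⟩ := hupp
  exact ⟨a, ha, b, hb, hay, hyb⟩

end MonotoneInverse

/-- A monotone function on an interval `I` induces a measure on `I` which gives to every relatively
open subinterval the length of the convex hull of its image. -/
lemma exists_measure_eq_volume_imageHull {v : ℝ → ℝ} {I : Set ℝ} (hv : MonotoneOn v I)
    (hI : I.OrdConnected) :
    ∃ ν : Measure ℝ, ν Iᶜ = 0 ∧ ∀ J : Set ℝ, J ⊆ I → J.OrdConnected →
      (∃ U : Set ℝ, IsOpen U ∧ J = U ∩ I) → ν J = volume (imageHull v J) := by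
  have hW : MeasurableSet (interior (imageHull v I)) := isOpen_interior.measurableSet
  have hg : AEMeasurable (monotoneInverse v I) (volume.restrict (interior (imageHull v I))) :=
    aemeasurable_restrict_of_monotoneOn hW (monotoneOn_monotoneInverse hv)
  refine ⟨(volume.restrict (interior (imageHull v I))).map (monotoneInverse v I), ?_, ?_⟩
  · rw [Measure.map_apply_of_aemeasurable hg hI.measurableSet.compl, Measure.restrict_apply' hW]
    convert measure_empty (μ := volume)
    ext y
    simp only [mem_inter_iff, mem_preimage, mem_compl_iff, mem_empty_iff_false, iff_false, not_and]
    exact fun h hy => h (monotoneInverse_mem hv subset_rfl hI hy)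
  · rintro J hJI hJ ⟨U, hU, rfl⟩
    rw [Measure.map_apply_of_aemeasurable hg hJ.measurableSet, Measure.restrict_apply' hW]
    apply le_antisymm
    · exact measure_mono fun y hy => mem_imageHull_of_monotoneInverse_mem hv hI hU hy.2 hy.1
    · rw [← volume_interior_imageHull]
      exact measure_mono fun y hy => ⟨monotoneInverse_mem hv hJI hJ hy,
        interior_mono (imageHull_mono v hJI) hy⟩

/-- Every point of a set `I` of reals has an open order-connected neighborhood whose trace on `I` is
contained in a compact interval with endpoints in `I`. -/
lemma exists_isOpen_ordConnected_inter_subset_Icc {I : Set ℝ} {x : ℝ} (hx : x ∈ I) :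
    ∃ U : Set ℝ, IsOpen U ∧ U.OrdConnected ∧ x ∈ U ∧
      ∃ a ∈ I, ∃ b ∈ I, a ≤ b ∧ U ∩ I ⊆ Icc a b := by
  obtain ⟨U, hU, hUo, hxU, a, ha, hax, hUa⟩ : ∃ U : Set ℝ, IsOpen U ∧ U.OrdConnected ∧ x ∈ U ∧
      ∃ a ∈ I, a ≤ x ∧ U ∩ I ⊆ Ici a := by
    by_cases h : ∃ a ∈ I, a < x
    · obtain ⟨a, ha, hax⟩ := h
      exact ⟨Ioi a, isOpen_Ioi, ordConnected_Ioi, hax, a, ha, hax.le,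
        fun y hy => mem_Ioi.1 hy.1 |>.le⟩
    · push Not at h
      exact ⟨univ, isOpen_univ, ordConnected_univ, mem_univ x, x, hx, le_rfl, fun y hy => h y hy.2⟩
  obtain ⟨V, hV, hVo, hxV, b, hb, hxb, hVb⟩ : ∃ V : Set ℝ, IsOpen V ∧ V.OrdConnected ∧ x ∈ V ∧
      ∃ b ∈ I, x ≤ b ∧ V ∩ I ⊆ Iic b := by
    by_cases h : ∃ b ∈ I, x < b
    · obtain ⟨b, hb, hxb⟩ := h
      exact ⟨Iio b, isOpen_Iio, ordConnected_Iio, hxb, b, hb, hxb.le,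
        fun y hy => mem_Iio.1 hy.1 |>.le⟩
    · push Not at h
      exact ⟨univ, isOpen_univ, ordConnected_univ, mem_univ x, x, hx, le_rfl, fun y hy => h y hy.2⟩
  exact ⟨U ∩ V, hU.inter hV, hUo.inter hVo, ⟨hxU, hxV⟩, a, ha, b, hb, hax.trans hxb,
    fun y hy => ⟨hUa ⟨hy.1.1, hy.2⟩, hVb ⟨hy.1.2, hy.2⟩⟩⟩

/-- Two measures carried by a set `I` agree if they agree on the traces of open intervals
and every point of `I` has an open interval neighborhood whose trace has finite measure. -/
lemma measure_ext_of_relatively_open_intervals {I : Set ℝ} {μ ν : Measure ℝ}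
    (hμI : μ Iᶜ = 0) (hνI : ν Iᶜ = 0)
    (h : ∀ U : Set ℝ, IsOpen U → U.OrdConnected → μ (U ∩ I) = ν (U ∩ I))
    (hfin : ∀ x ∈ I, ∃ U : Set ℝ, IsOpen U ∧ U.OrdConnected ∧ x ∈ U ∧ μ (U ∩ I) < ⊤) :
    μ = ν := by
  choose! U hU hUo hxU hUfin using hfin
  obtain ⟨t, htI, htc, hcover⟩ := TopologicalSpace.countable_cover_nhdsWithin
    (f := fun x => U x ∩ I) (s := I) fun x hx =>
      inter_mem (mem_nhdsWithin_of_mem_nhds ((hU x hx).mem_nhds (hxU x hx))) self_mem_nhdsWithin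
  have hres : μ.restrict I = ν.restrict I := by
    have heq : I = ⋃ x ∈ t, U x ∩ I :=
      hcover.antisymm (iUnion₂_subset fun x _ => inter_subset_right)
    rw [heq, Measure.restrict_biUnion_congr htc]
    intro x hx
    have : IsFiniteMeasure (μ.restrict (U x ∩ I)) := ⟨by simpa using hUfin x (htI hx)⟩
    refine Real.measure_ext_Ioo_rat fun a b => ?_
    rw [Measure.restrict_apply measurableSet_Ioo, Measure.restrict_apply measurableSet_Ioo,
      ← inter_assoc]
    exact h _ (isOpen_Ioo.inter (hU x (htI hx))) (ordConnected_Ioo.inter (hUo x (htI hx)))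
  rwa [Measure.restrict_eq_self_of_ae_mem (mem_ae_iff.2 hμI),
    Measure.restrict_eq_self_of_ae_mem (mem_ae_iff.2 hνI)] at hres

/-- For `γ : I → X` locally of bounded variation there exists a unique Borel
measure `ν` on `I` (realized as a measure on `ℝ` vanishing outside `I`) such that
`ν(J) = Var(γ;J)` for every subinterval `J ⊆ I` that is open in the relative topology
of `I`. -/
theorem speed_measure_exists_unique {X : Type*} [MetricSpace X]
    (I : Set ℝ) (hI : I.OrdConnected) (γ : ℝ → X)
    (hγ : ∀ a ∈ I, ∀ b ∈ I, a ≤ b → eVariationOn γ (Set.Icc a b) < ⊤) :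
    ∃! ν : Measure ℝ,
      ν Iᶜ = 0 ∧
      ∀ J : Set ℝ, J ⊆ I → J.OrdConnected → (∃ U : Set ℝ, IsOpen U ∧ J = U ∩ I) →
        ν J = eVariationOn γ J := by
  have hloc : LocallyBoundedVariationOn γ I := by
    intro a b ha hb
    rcases le_total a b with hab | hba
    · exact ne_top_of_le_ne_top (hγ a ha b hb hab).ne (eVariationOn.mono γ inter_subset_right)
    · rw [BoundedVariationOn, eVariationOn.subsingleton γ]
      · simp
      · exact (subsingleton_Icc_of_ge hba).anti inter_subset_right
  obtain ⟨v, hv, hvγ⟩ : ∃ v : ℝ → ℝ, MonotoneOn v I ∧ ∀ a ∈ I, ∀ b ∈ I, a ≤ b →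
      ENNReal.ofReal (v b - v a) = eVariationOn γ (Icc a b) := by
    rcases I.eq_empty_or_nonempty with rfl | ⟨c, hc⟩
    · exact ⟨fun _ => 0, by simp [MonotoneOn], by simp⟩
    refine ⟨variationOnFromTo γ I c, variationOnFromTo.monotoneOn hloc hc, fun a ha b hb hab => ?_⟩
    rw [← variationOnFromTo.add hloc hc ha hb, add_sub_cancel_left,
      variationOnFromTo.eq_of_le γ I hab, inter_eq_self_of_subset_right (hI.out ha hb),
      ENNReal.ofReal_toReal (hγ a ha b hb hab).ne]
  obtain ⟨ν, hνI, hν⟩ := exists_measure_eq_volume_imageHull hv hI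
  have hνγ : ∀ J : Set ℝ, J ⊆ I → J.OrdConnected → (∃ U : Set ℝ, IsOpen U ∧ J = U ∩ I) →
      ν J = eVariationOn γ J := fun J hJI hJ hJU => by
    rw [hν J hJI hJ hJU]
    exact volume_imageHull_eq_eVariationOn hJ (hv.mono hJI)
      fun a ha b hb => hvγ a (hJI ha) b (hJI hb)
  refine ⟨ν, ⟨hνI, hνγ⟩, fun μ ⟨hμI, hμ⟩ => ?_⟩
  refine measure_ext_of_relatively_open_intervals hμI hνI (fun U hU hUo => ?_) fun x hx => ?_
  · rw [hμ _ inter_subset_right (hUo.inter hI) ⟨U, hU, rfl⟩,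
      hνγ _ inter_subset_right (hUo.inter hI) ⟨U, hU, rfl⟩]
  · obtain ⟨U, hU, hUo, hxU, a, ha, b, hb, hab, hsub⟩ :=
      exists_isOpen_ordConnected_inter_subset_Icc hx
    refine ⟨U, hU, hUo, hxU, ?_⟩
    rw [hμ _ inter_subset_right (hUo.inter hI) ⟨U, hU, rfl⟩]
    exact (eVariationOn.mono γ hsub).trans_lt (hγ a ha b hb hab)
end

section
/- (Banach–Zaretsky theorem, speed measure version.) Let γ : I → X. Then γ is locally absolutely continuous if and only if γ is locally of bounded variation and its speed measure ν is absolutely continuous with respect to Lebesgue measure λ (i.e. λ(N) = 0 implies ν(N) = 0 for every Borel set N ⊆ I). -/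
open Filter Topology Set MeasureTheory

/-- `ν` is the speed measure of `γ` on the interval `I`. -/
def IsSpeedMeasure {X : Type*} [MetricSpace X] (γ : ℝ → X) (I : Set ℝ)
    (ν : Measure ℝ) : Prop :=
  ν Iᶜ = 0 ∧
  ∀ J : Set ℝ, J ⊆ I → J.OrdConnected → (∃ U : Set ℝ, IsOpen U ∧ J = U ∩ I) →
    ν J = eVariationOn γ J

/-- `γ` is (metrically) absolutely continuous on the set `S`: for every `ε > 0` there is
`δ > 0` such that for all finitely many pairwise disjoint open subintervals
`(a_k, b_k)` of `S` with `∑ (b_k - a_k) ≤ δ` one has `∑ d(γ(a_k), γ(b_k)) ≤ ε`. -/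
def MetricAC {X : Type*} [MetricSpace X] (γ : ℝ → X) (S : Set ℝ) : Prop :=
  ∀ ε : ℝ, 0 < ε → ∃ δ : ℝ, 0 < δ ∧
    ∀ (n : ℕ) (a b : ℕ → ℝ),
      (∀ k < n, a k ∈ S ∧ b k ∈ S ∧ a k ≤ b k) →
      (∀ j < n, ∀ k < n, j ≠ k → Disjoint (Set.Ioo (a j) (b j)) (Set.Ioo (a k) (b k))) →
      (∑ k ∈ Finset.range n, (b k - a k)) ≤ δ →
      (∑ k ∈ Finset.range n, dist (γ (a k)) (γ (b k))) ≤ ε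

/-- `γ` is locally absolutely continuous on the interval `I`: absolutely continuous on
every compact subinterval of `I`. -/
def MetricACloc {X : Type*} [MetricSpace X] (γ : ℝ → X) (I : Set ℝ) : Prop :=
  ∀ a ∈ I, ∀ b ∈ I, a ≤ b → MetricAC γ (Set.Icc a b)

open scoped ENNReal

/-- The defining bound of metric absolute continuity, for families indexed by a finite set. -/
theorem sum_dist_le_of_forall_range {X ι : Type*} [MetricSpace X] {γ : ℝ → X} {S : Set ℝ}
    {ε δ : ℝ}
    (h : ∀ (n : ℕ) (a b : ℕ → ℝ),
      (∀ k < n, a k ∈ S ∧ b k ∈ S ∧ a k ≤ b k) →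
      (∀ j < n, ∀ k < n, j ≠ k → Disjoint (Ioo (a j) (b j)) (Ioo (a k) (b k))) →
      (∑ k ∈ Finset.range n, (b k - a k)) ≤ δ →
      (∑ k ∈ Finset.range n, dist (γ (a k)) (γ (b k))) ≤ ε)
    (s : Finset ι) (a b : ι → ℝ) (hab : ∀ i ∈ s, a i ∈ S ∧ b i ∈ S ∧ a i ≤ b i)
    (hd : (s : Set ι).PairwiseDisjoint fun i ↦ Ioo (a i) (b i))
    (hsum : ∑ i ∈ s, (b i - a i) ≤ δ) :
    ∑ i ∈ s, dist (γ (a i)) (γ (b i)) ≤ ε := by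
  let e := s.equivFin
  let extend (f : ι → ℝ) (k : ℕ) : ℝ := if hk : k < s.card then f (e.symm ⟨k, hk⟩) else 0
  have hext (f : ι → ℝ) (k : Fin s.card) : extend f k = f (e.symm k) := by simp [extend]
  have key (F : ℝ → ℝ → ℝ) :
      ∑ k ∈ Finset.range s.card, F (extend a k) (extend b k) = ∑ i ∈ s, F (a i) (b i) := by
    rw [Finset.sum_range]
    simp_rw [hext]
    rw [e.symm.sum_comp (fun i : s ↦ F (a i) (b i))]
    exact Finset.sum_coe_sort s fun i ↦ F (a i) (b i)
  have := h s.card (extend a) (extend b) ?_ ?_ ?_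
  · rwa [key fun x y ↦ dist (γ x) (γ y)] at this
  · intro k hk
    simpa [extend, hk] using hab _ (e.symm ⟨k, hk⟩).2
  · intro j hj k hk hjk
    simp only [extend, hj, hk, dif_pos]
    refine hd (e.symm ⟨j, hj⟩).2 (e.symm ⟨k, hk⟩).2 fun hne ↦ hjk ?_
    simpa using hne
  · rwa [key fun x y ↦ y - x]

/-- The total variation over a finite disjoint family of intervals of small total length. -/
theorem sum_eVariationOn_le_of_forall_range {X ι : Type*} [MetricSpace X] {γ : ℝ → X} {S : Set ℝ}
    {ε δ : ℝ} (hδ : 0 ≤ δ)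
    (h : ∀ (n : ℕ) (a b : ℕ → ℝ),
      (∀ k < n, a k ∈ S ∧ b k ∈ S ∧ a k ≤ b k) →
      (∀ j < n, ∀ k < n, j ≠ k → Disjoint (Ioo (a j) (b j)) (Ioo (a k) (b k))) →
      (∑ k ∈ Finset.range n, (b k - a k)) ≤ δ →
      (∑ k ∈ Finset.range n, dist (γ (a k)) (γ (b k))) ≤ ε)
    (s : Finset ι) (J : ι → Set ℝ) (hJ : ∀ i ∈ s, (J i).OrdConnected) (hJS : ∀ i ∈ s, J i ⊆ S)
    (hd : (s : Set ι).PairwiseDisjoint J)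
    (hsum : ∑ i ∈ s, volume (J i) ≤ ENNReal.ofReal δ) :
    ∑ i ∈ s, eVariationOn γ (J i) ≤ ENNReal.ofReal ε := by
  classical
  wlog hne : ∀ i ∈ s, (J i).Nonempty generalizing s
  · rw [← Finset.sum_filter_of_ne (p := fun i ↦ (J i).Nonempty)]
    · refine this _ (fun i hi ↦ hJ i (Finset.mem_filter.1 hi).1)
        (fun i hi ↦ hJS i (Finset.mem_filter.1 hi).1) (hd.subset fun i hi ↦ (Finset.mem_filter.1 hi).1)
        ((Finset.sum_le_sum_of_subset (Finset.filter_subset _ _)).trans hsum)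
        (fun i hi ↦ (Finset.mem_filter.1 hi).2)
    · intro i _ hi
      by_contra hemp
      simp [not_nonempty_iff_eq_empty.1 hemp] at hi
  let P (i : s) := ℕ × { u : ℕ → ℝ // Monotone u ∧ ∀ k, u k ∈ J i }
  have : ∀ i, Nonempty (P i) := fun i ↦
    ⟨0, (eVariationOn.nonempty_monotone_mem (hne i i.2)).some⟩
  let f (i : s) (p : P i) : ℝ≥0∞ :=
    ∑ k ∈ Finset.range p.1, edist (γ (p.2.1 (k + 1))) (γ (p.2.1 k))
  have hvar (i : s) : eVariationOn γ (J i) = ⨆ p : ∀ i, P i, f i (p i) :=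
    ((Function.surjective_eval i).iSup_comp (f i)).symm
  rw [← Finset.sum_coe_sort s]
  simp_rw [hvar]
  rw [ENNReal.finsetSum_iSup]
  · refine iSup_le fun p ↦ ?_
    let t : Finset (Σ _ : s, ℕ) := Finset.univ.sigma fun i ↦ Finset.range (p i).1
    let u (i : s) : ℕ → ℝ := (p i).2.1
    have hu (i : s) : Monotone (u i) := (p i).2.2.1
    have huJ (i : s) (k : ℕ) : u i k ∈ J i := (p i).2.2.2 k
    have hIoo (i : s) (k : ℕ) : Ioo (u i k) (u i (k + 1)) ⊆ J i :=
      Ioo_subset_Icc_self.trans ((hJ i i.2).out (huJ i _) (huJ i _))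
    have hlen (i : s) (n : ℕ) : ENNReal.ofReal (u i n - u i 0) ≤ volume (J i) := by
      rw [← Real.volume_Icc]
      exact measure_mono ((hJ i i.2).out (huJ i _) (huJ i _))
    have key := sum_dist_le_of_forall_range h t (fun x ↦ u x.1 x.2) (fun x ↦ u x.1 (x.2 + 1))
      (fun x _ ↦ ⟨hJS _ x.1.2 (huJ _ _), hJS _ x.1.2 (huJ _ _), hu _ (Nat.le_succ _)⟩) ?_ ?_
    · simp only [f]
      have := ENNReal.ofReal_le_ofReal key
      rw [ENNReal.ofReal_sum_of_nonneg fun _ _ ↦ dist_nonneg, Finset.sum_sigma] at this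
      simpa only [← edist_dist, edist_comm] using this
    · rintro ⟨i, j⟩ - ⟨i', k⟩ - hne'
      by_cases hii : i = i'
      · subst hii
        have hjk : j ≠ k := fun hjk ↦ hne' (by rw [hjk])
        exact (hu i).pairwise_disjoint_on_Ioo_succ hjk
      · exact (hd i.2 i'.2 fun hc ↦ hii (Subtype.ext hc)).mono (hIoo i j) (hIoo i' k)
    · rw [← ENNReal.ofReal_le_ofReal_iff hδ, Finset.sum_sigma]
      refine le_trans ?_ hsum
      simp_rw [Finset.sum_range_sub]
      rw [ENNReal.ofReal_sum_of_nonneg fun i _ ↦ sub_nonneg.2 (hu i (Nat.zero_le _)),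
        ← Finset.sum_coe_sort s]
      exact Finset.sum_le_sum fun i _ ↦ hlen i _
  · intro p q
    refine ⟨fun i ↦ if f i (p i) ≤ f i (q i) then q i else p i, fun i ↦ ?_⟩
    dsimp only
    split_ifs with hpq
    · exact ⟨hpq, le_rfl⟩
    · exact ⟨le_rfl, (not_le.1 hpq).le⟩

theorem MetricAC.boundedVariationOn {X : Type*} [MetricSpace X] {γ : ℝ → X} {a b : ℝ}
    (h : MetricAC γ (Icc a b)) : BoundedVariationOn γ (Icc a b) := by
  obtain ⟨δ, hδ, H⟩ := h 1 one_pos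
  have hshort (x y : ℝ) (hax : a ≤ x) (hyb : y ≤ b) (hxy : y - x ≤ δ) :
      eVariationOn γ (Icc x y) ≤ ENNReal.ofReal 1 := by
    simpa using sum_eVariationOn_le_of_forall_range hδ.le H {()} (fun _ ↦ Icc x y)
      (fun _ _ ↦ ordConnected_Icc) (fun _ _ ↦ Icc_subset_Icc hax hyb) (by simp)
      (by simpa using ENNReal.ofReal_le_ofReal hxy)
  have hall (n : ℕ) : ∀ y ≤ b, y ≤ a + n * δ → eVariationOn γ (Icc a y) ≠ ⊤ := by
    induction n with
    | zero =>
      intro y _ hy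
      rw [eVariationOn.subsingleton]
      · exact ENNReal.zero_ne_top
      · exact Set.subsingleton_Icc_of_ge (by simpa using hy)
    | succ n ih =>
      intro y hyb hy
      rcases lt_or_ge y (a + δ) with hya | hya
      · exact ne_top_of_le_ne_top ENNReal.ofReal_ne_top (hshort a y le_rfl hyb (by linarith))
      · have hsplit := eVariationOn.Icc_add_Icc γ (s := univ) (a := a) (b := y - δ) (c := y)
          (by linarith) (by linarith) (mem_univ _)
        simp only [univ_inter] at hsplit
        rw [← hsplit]
        refine ENNReal.add_ne_top.2 ⟨ih _ (by linarith) ?_,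
          ne_top_of_le_ne_top ENNReal.ofReal_ne_top
            (hshort (y - δ) y (by linarith) hyb (by linarith))⟩
        push_cast at hy
        linarith
  obtain ⟨n, hn⟩ := exists_nat_ge ((b - a) / δ)
  refine hall n b le_rfl ?_
  rw [div_le_iff₀ hδ] at hn
  linarith

/-- A compact subinterval of `I` has a relative neighbourhood inside a compact subinterval. -/
theorem exists_isOpen_inter_subset_Icc {I : Set ℝ} {a b : ℝ}
    (ha : a ∈ I) (hb : b ∈ I) (hab : a ≤ b) :
    ∃ a' ∈ I, ∃ b' ∈ I, a' ≤ b' ∧ ∃ U : Set ℝ, IsOpen U ∧ U.OrdConnected ∧ Icc a b ⊆ U ∧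
      U ∩ I ⊆ Icc a' b' := by
  obtain ⟨a', ha', haa, U, hU, hUc, haU, hUI⟩ : ∃ a' ∈ I, a' ≤ a ∧ ∃ U : Set ℝ, IsOpen U ∧
      U.OrdConnected ∧ Ici a ⊆ U ∧ U ∩ I ⊆ Ici a' := by
    by_cases h : ∃ a' ∈ I, a' < a
    · obtain ⟨a', ha', haa⟩ := h
      exact ⟨a', ha', haa.le, Ioi a', isOpen_Ioi, ordConnected_Ioi, Ici_subset_Ioi.2 haa,
        fun x hx ↦ le_of_lt (mem_Ioi.1 hx.1)⟩
    · push Not at h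
      exact ⟨a, ha, le_rfl, univ, isOpen_univ, ordConnected_univ, subset_univ _,
        fun x hx ↦ h x hx.2⟩
  obtain ⟨b', hb', hbb, V, hV, hVc, hbV, hVI⟩ : ∃ b' ∈ I, b ≤ b' ∧ ∃ V : Set ℝ, IsOpen V ∧
      V.OrdConnected ∧ Iic b ⊆ V ∧ V ∩ I ⊆ Iic b' := by
    by_cases h : ∃ b' ∈ I, b < b'
    · obtain ⟨b', hb', hbb⟩ := h
      exact ⟨b', hb', hbb.le, Iio b', isOpen_Iio, ordConnected_Iio, Iic_subset_Iio.2 hbb,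
        fun x hx ↦ le_of_lt (mem_Iio.1 hx.1)⟩
    · push Not at h
      exact ⟨b, hb, le_rfl, univ, isOpen_univ, ordConnected_univ, subset_univ _,
        fun x hx ↦ h x hx.2⟩
  exact ⟨a', ha', b', hb', haa.trans (hab.trans hbb), U ∩ V, hU.inter hV, hUc.inter hVc,
    fun x hx ↦ ⟨haU hx.1, hbV hx.2⟩, fun x hx ↦ ⟨hUI ⟨hx.1.1, hx.2⟩, hVI ⟨hx.1.2, hx.2⟩⟩⟩

/-- The speed measure of a relatively open set is controlled by the variations over the
components of the open set. -/
theorem IsSpeedMeasure.measure_inter_le {X : Type*} [MetricSpace X] {γ : ℝ → X} {I S : Set ℝ}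
    (hI : I.OrdConnected) {ν : Measure ℝ} (hν : IsSpeedMeasure γ I ν)
    {ε δ : ℝ} (hδ : 0 ≤ δ)
    (h : ∀ (n : ℕ) (a b : ℕ → ℝ),
      (∀ k < n, a k ∈ S ∧ b k ∈ S ∧ a k ≤ b k) →
      (∀ j < n, ∀ k < n, j ≠ k → Disjoint (Ioo (a j) (b j)) (Ioo (a k) (b k))) →
      (∑ k ∈ Finset.range n, (b k - a k)) ≤ δ →
      (∑ k ∈ Finset.range n, dist (γ (a k)) (γ (b k))) ≤ ε)
    {U : Set ℝ} (hU : IsOpen U) (hUS : U ∩ I ⊆ S) (hvol : volume U ≤ ENNReal.ofReal δ) :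
    ν (U ∩ I) ≤ ENNReal.ofReal ε := by
  let 𝒞 : Set (Set ℝ) := connectedComponentIn U '' U
  have hopen : ∀ C ∈ 𝒞, IsOpen C := by
    rintro _ ⟨x, -, rfl⟩
    exact hU.connectedComponentIn
  have hord : ∀ C ∈ 𝒞, C.OrdConnected := by
    rintro _ ⟨x, -, rfl⟩
    exact isPreconnected_connectedComponentIn.ordConnected
  have hsub : ∀ C ∈ 𝒞, C ⊆ U := by
    rintro _ ⟨x, -, rfl⟩
    exact connectedComponentIn_subset U x
  have hdisj : 𝒞.PairwiseDisjoint id := by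
    rintro _ ⟨x, -, rfl⟩ _ ⟨y, -, rfl⟩ hxy
    refine Set.disjoint_left.2 fun z hzx hzy ↦ hxy ?_
    rw [connectedComponentIn_eq hzx, connectedComponentIn_eq hzy]
  have hcount : 𝒞.Countable := hdisj.countable_of_isOpen hopen (by
    rintro _ ⟨x, hx, rfl⟩
    exact ⟨x, mem_connectedComponentIn hx⟩)
  have := hcount.to_subtype
  have hcover : U ∩ I ⊆ ⋃ C : 𝒞, (C : Set ℝ) ∩ I := fun x hx ↦
    mem_iUnion.2 ⟨⟨_, x, hx.1, rfl⟩, mem_connectedComponentIn hx.1, hx.2⟩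
  calc ν (U ∩ I) ≤ ∑' C : 𝒞, ν ((C : Set ℝ) ∩ I) :=
        (measure_mono hcover).trans (measure_iUnion_le _)
    _ = ∑' C : 𝒞, eVariationOn γ ((C : Set ℝ) ∩ I) := tsum_congr fun C ↦
        hν.2 _ inter_subset_right ((hord C C.2).inter hI) ⟨C, hopen C C.2, rfl⟩
    _ ≤ ENNReal.ofReal ε := by
        rw [ENNReal.tsum_eq_iSup_sum]
        refine iSup_le fun s ↦ ?_
        have hd : (s : Set 𝒞).PairwiseDisjoint fun C ↦ (C : Set ℝ) ∩ I :=
          fun C _ D _ hCD ↦ (hdisj C.2 D.2 fun hc ↦ hCD (Subtype.ext hc)).mono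
            inter_subset_left inter_subset_left
        refine sum_eVariationOn_le_of_forall_range hδ h s _
          (fun C _ ↦ (hord C C.2).inter hI)
          (fun C _ ↦ (inter_subset_inter_left _ (hsub C C.2)).trans hUS) hd ?_
        rw [← measure_biUnion_finset hd
          fun C _ ↦ (hopen C C.2).measurableSet.inter hI.measurableSet]
        refine (measure_mono (iUnion₂_subset fun C _ ↦ ?_)).trans hvol
        exact inter_subset_left.trans (hsub C C.2)

theorem MetricACloc.measure_eq_zero {X : Type*} [MetricSpace X] {γ : ℝ → X} {I : Set ℝ}
    (hI : I.OrdConnected) (hγ : MetricACloc γ I) {ν : Measure ℝ} (hν : IsSpeedMeasure γ I ν)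
    {N : Set ℝ} (hN : N ⊆ I) (hN0 : volume N = 0) : ν N = 0 := by
  refine measure_null_of_locally_null N fun x hx ↦ ?_
  obtain ⟨a, ha, b, hb, hab, V, hV, -, hxV, hVI⟩ :=
    exists_isOpen_inter_subset_Icc (hN hx) (hN hx) le_rfl
  refine ⟨N ∩ V, inter_mem self_mem_nhdsWithin
    (mem_nhdsWithin_of_mem_nhds (hV.mem_nhds (hxV (by simp)))), ?_⟩
  refine le_antisymm (ENNReal.le_of_forall_pos_le_add fun ε hε _ ↦ ?_) zero_le
  obtain ⟨δ, hδ, H⟩ := hγ a ha b hb hab ε (by exact_mod_cast hε)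
  obtain ⟨U, hNU, hU, hUδ⟩ := N.exists_isOpen_lt_of_lt (μ := volume) (ENNReal.ofReal δ)
    (by rw [hN0]; exact ENNReal.ofReal_pos.2 hδ)
  rw [zero_add, ← ENNReal.ofReal_coe_nnreal]
  refine (measure_mono (t := U ∩ V ∩ I) fun y hy ↦ ⟨⟨hNU hy.1, hy.2⟩, hN hy.1⟩).trans ?_
  exact hν.measure_inter_le hI hδ.le H (hU.inter hV)
    ((inter_subset_inter_left _ inter_subset_right).trans hVI)
    ((measure_mono inter_subset_left).trans hUδ.le)

/-- The Lebesgue–Stieltjes measure of a monotone function on an interval `I`, relative to `I`. -/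
theorem MonotoneOn.exists_measure {I : Set ℝ} (hI : I.OrdConnected) {V : ℝ → ℝ}
    (hV : MonotoneOn V I) :
    ∃ ν : Measure ℝ, ν Iᶜ = 0 ∧
      (∀ J ⊆ I, J.OrdConnected → ∀ p ∈ J, ∀ q ∈ J, ENNReal.ofReal (V q - V p) ≤ ν J) ∧
      ∀ U : Set ℝ, IsOpen U → ∀ M : ℝ≥0∞,
        (∀ p ∈ U ∩ I, ∀ q ∈ U ∩ I, p ≤ q → ENNReal.ofReal (V q - V p) ≤ M) →
        ν (U ∩ I) ≤ M := by
  let H : Set ℝ := ⋃ p ∈ I, ⋃ q ∈ I, Ioo (V p) (V q)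
  have hH : MeasurableSet H :=
    (isOpen_biUnion fun _ _ ↦ isOpen_biUnion fun _ _ ↦ isOpen_Ioo).measurableSet
  have hmem {y : ℝ} : y ∈ H ↔ ∃ p ∈ I, ∃ q ∈ I, V p < y ∧ y < V q := by
    simp only [H, mem_iUnion, mem_Ioo, exists_prop]
  let T (y : ℝ) : ℝ := sSup {t ∈ I | V t ≤ y}
  have hub {y q : ℝ} (hq : q ∈ I) (hyq : y < V q) : q ∈ upperBounds {t ∈ I | V t ≤ y} := by
    rintro t ⟨ht, hty⟩
    by_contra! hqt
    exact absurd (hV hq ht hqt.le) (by linarith)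
  have hbdd {y : ℝ} (hy : y ∈ H) : BddAbove {t ∈ I | V t ≤ y} := by
    obtain ⟨p, hp, q, hq, hpy, hyq⟩ := hmem.1 hy
    exact ⟨q, hub hq hyq⟩
  have hnon {y : ℝ} (hy : y ∈ H) : {t ∈ I | V t ≤ y}.Nonempty := by
    obtain ⟨p, hp, q, hq, hpy, hyq⟩ := hmem.1 hy
    exact ⟨p, hp, hpy.le⟩
  have le_T {y p : ℝ} (hy : y ∈ H) (hp : p ∈ I) (hpy : V p ≤ y) : p ≤ T y :=
    le_csSup (hbdd hy) ⟨hp, hpy⟩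
  have T_le {y q : ℝ} (hy : y ∈ H) (hq : q ∈ I) (hyq : y < V q) : T y ≤ q :=
    csSup_le (hnon hy) (hub hq hyq)
  have hT : MonotoneOn T H := fun x hx y hy hxy ↦
    csSup_le_csSup (hbdd hy) (hnon hx) fun t ht ↦ ⟨ht.1, ht.2.trans hxy⟩
  have hTm : AEMeasurable T (volume.restrict H) := aemeasurable_restrict_of_monotoneOn hH hT
  have hν {J : Set ℝ} (hJ : MeasurableSet J) :
      (volume.restrict H).map T J = volume (T ⁻¹' J ∩ H) := by
    rw [Measure.map_apply_of_aemeasurable hTm hJ, Measure.restrict_apply' hH]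
  refine ⟨(volume.restrict H).map T, ?_, ?_, ?_⟩
  · rw [hν hI.measurableSet.compl]
    convert measure_empty (μ := (volume : Measure ℝ))
    refine eq_empty_of_forall_notMem fun y ⟨hyI, hy⟩ ↦ hyI ?_
    obtain ⟨p, hp, q, hq, hpy, hyq⟩ := hmem.1 hy
    exact hI.out hp hq ⟨le_T hy hp hpy.le, T_le hy hq hyq⟩
  · intro J hJI hJ p hp q hq
    rw [hν hJ.measurableSet, ← Real.volume_Ioo]
    refine measure_mono fun y hy ↦ ?_
    have hyH : y ∈ H := hmem.2 ⟨p, hJI hp, q, hJI hq, hy.1, hy.2⟩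
    exact ⟨hJ.out hp hq ⟨le_T hyH (hJI hp) hy.1.le, T_le hyH (hJI hq) hy.2⟩, hyH⟩
  · intro U hU M hM
    rw [hν (hU.measurableSet.inter hI.measurableSet)]
    have hbetween : ∀ y ∈ T ⁻¹' (U ∩ I) ∩ H, ∃ p ∈ U ∩ I, ∃ q ∈ U ∩ I, V p ≤ y ∧ y ≤ V q := by
      rintro y ⟨⟨hyU, hyI⟩, hy⟩
      obtain ⟨p, hp, q, hq, hpy, hyq⟩ := hmem.1 hy
      obtain ⟨r, hr, hrU⟩ := Metric.isOpen_iff.1 hU (T y) hyU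
      have hlow : ∃ p' ∈ U ∩ I, V p' ≤ y := by
        rcases (le_T hy hp hpy.le).eq_or_lt with hpT | hpT
        · exact ⟨p, ⟨hpT ▸ hyU, hp⟩, hpy.le⟩
        · obtain ⟨p', hp', hp'T⟩ := exists_between (max_lt hpT (sub_lt_self (T y) hr))
          obtain ⟨hpp', hrp'⟩ := max_lt_iff.1 hp'
          have hp'I : p' ∈ I := hI.out hp hyI ⟨hpp'.le, hp'T.le⟩
          obtain ⟨t, ⟨ht, hty⟩, hp't⟩ := exists_lt_of_lt_csSup (hnon hy) hp'T
          refine ⟨p', ⟨hrU ?_, hp'I⟩, (hV hp'I ht hp't.le).trans hty⟩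
          rw [Metric.mem_ball, Real.dist_eq, abs_lt]
          constructor <;> linarith
      have hupp : ∃ q' ∈ U ∩ I, y ≤ V q' := by
        rcases (T_le hy hq hyq).eq_or_lt with hTq | hTq
        · exact ⟨q, ⟨hTq ▸ hyU, hq⟩, hyq.le⟩
        · obtain ⟨q', hTq', hq'⟩ := exists_between (lt_min hTq (lt_add_of_pos_right (T y) hr))
          obtain ⟨hq'q, hq'r⟩ := lt_min_iff.1 hq'
          have hq'I : q' ∈ I := hI.out hyI hq ⟨hTq'.le, hq'q.le⟩
          refine ⟨q', ⟨hrU ?_, hq'I⟩, ?_⟩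
          · rw [Metric.mem_ball, Real.dist_eq, abs_lt]
            constructor <;> linarith
          · by_contra! hlt
            exact absurd (le_T hy hq'I hlt.le) (not_le.2 hTq')
      obtain ⟨p', hp', hpy'⟩ := hlow
      obtain ⟨q', hq', hyq'⟩ := hupp
      exact ⟨p', hp', q', hq', hpy', hyq'⟩
    have hsub : ∀ x ∈ T ⁻¹' (U ∩ I) ∩ H, ∀ y ∈ T ⁻¹' (U ∩ I) ∩ H, ENNReal.ofReal (y - x) ≤ M := by
      intro x hx y hy
      obtain ⟨p, hp, -, -, hpx, -⟩ := hbetween x hx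
      obtain ⟨-, -, q, hq, -, hyq⟩ := hbetween y hy
      refine (ENNReal.ofReal_le_ofReal (by linarith : y - x ≤ V q - V p)).trans ?_
      rcases le_total p q with hpq | hqp
      · exact hM p hp q hq hpq
      · rw [ENNReal.ofReal_of_nonpos (sub_nonpos.2 (hV hq.2 hp.2 hqp))]
        exact zero_le
    refine (Real.volume_le_diam _).trans (Metric.ediam_le fun x hx y hy ↦ ?_)
    rw [edist_dist, Real.dist_eq]
    rcases abs_choice (x - y) with h | h
    · rw [h]
      exact hsub y hy x hx
    · rw [h, neg_sub]
      exact hsub x hx y hy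

/-- Existence of the speed measure, which dominates the variation on every subinterval. -/
theorem exists_isSpeedMeasure {X : Type*} [MetricSpace X] {γ : ℝ → X} {I : Set ℝ}
    (hI : I.OrdConnected) (hγ : ∀ a ∈ I, ∀ b ∈ I, a ≤ b → eVariationOn γ (Icc a b) < ⊤) :
    ∃ ν : Measure ℝ, IsSpeedMeasure γ I ν ∧
      ∀ J ⊆ I, J.OrdConnected → eVariationOn γ J ≤ ν J := by
  have hloc : LocallyBoundedVariationOn γ I := by
    intro a b ha hb
    rcases le_or_gt a b with hab | hab
    · exact BoundedVariationOn.mono (hγ a ha b hb hab).ne inter_subset_right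
    · exact .of_subsingleton (by simp [Icc_eq_empty_of_lt hab])
  obtain ⟨V, hV, hVar⟩ : ∃ V : ℝ → ℝ, MonotoneOn V I ∧ ∀ p ∈ I, ∀ q ∈ I, p ≤ q →
      eVariationOn γ (I ∩ Icc p q) = ENNReal.ofReal (V q - V p) := by
    rcases I.eq_empty_or_nonempty with rfl | ⟨c, hc⟩
    · exact ⟨0, fun _ h ↦ h.elim, fun _ h ↦ h.elim⟩
    refine ⟨variationOnFromTo γ I c, variationOnFromTo.monotoneOn hloc hc, fun p hp q hq hpq ↦ ?_⟩
    rw [← variationOnFromTo.add hloc hc hp hq, add_sub_cancel_left,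
      variationOnFromTo.eq_of_le γ I hpq, ENNReal.ofReal_toReal (hloc p q hp hq)]
  obtain ⟨ν, hνI, hlow, hupp⟩ := hV.exists_measure hI
  have hle : ∀ J ⊆ I, J.OrdConnected → eVariationOn γ J ≤ ν J := by
    intro J hJI hJ
    rw [eVariationOn.eq_biSup_inter_Icc]
    refine iSup₂_le fun ⟨p, q⟩ ⟨hp, hq, hpq⟩ ↦ ?_
    refine le_trans (eVariationOn.mono γ (inter_subset_inter_left _ hJI)) ?_
    rw [hVar p (hJI hp) q (hJI hq) hpq]
    exact hlow J hJI hJ p hp q hq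
  refine ⟨ν, ⟨hνI, ?_⟩, hle⟩
  rintro J hJI hJ ⟨U, hU, rfl⟩
  refine le_antisymm (hupp U hU _ fun p hp q hq hpq ↦ ?_) (hle _ hJI hJ)
  rw [← hVar p hp.2 q hq.2 hpq]
  exact eVariationOn.mono γ (inter_subset_right.trans (hJ.out hp hq))

/-- The `ε`-`δ` form of absolute continuity of a finite measure. -/
theorem MeasureTheory.Measure.AbsolutelyContinuous.exists_forall_measure_lt {α : Type*}
    [MeasurableSpace α] {μ ν : Measure α} [SigmaFinite μ] [IsFiniteMeasure ν] (h : ν ≪ μ)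
    {ε : ℝ≥0∞} (hε : ε ≠ 0) : ∃ δ > 0, ∀ s, MeasurableSet s → μ s < δ → ν s < ε := by
  obtain ⟨δ, hδ, H⟩ := exists_pos_setLIntegral_lt_of_measure_lt
    (Measure.lintegral_rnDeriv_lt_top ν μ).ne hε
  refine ⟨δ, hδ, fun s hs hμs ↦ ?_⟩
  rw [← Measure.setLIntegral_rnDeriv h s]
  exact H s hμs

theorem metricAC_of_absolutelyContinuous {X : Type*} [MetricSpace X] {γ : ℝ → X} {S : Set ℝ}
    {ν : Measure ℝ} [IsFiniteMeasure ν] (hν : ν ≪ volume)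
    (hγ : ∀ s ∈ S, ∀ t ∈ S, s ≤ t → eVariationOn γ (Icc s t) ≤ ν (Icc s t)) :
    MetricAC γ S := by
  intro ε hε
  obtain ⟨δ, hδ, H⟩ := hν.exists_forall_measure_lt (ENNReal.ofReal_pos.2 hε).ne'
  obtain ⟨η, hη, hηδ⟩ := ENNReal.lt_iff_exists_real_btwn.1 hδ
  have hη0 : 0 < η := ENNReal.ofReal_pos.1 hηδ.1
  refine ⟨η, hη0, fun n a b hab hdisj hsum ↦ ?_⟩
  have hd : (Finset.range n : Set ℕ).PairwiseDisjoint fun k ↦ Ioo (a k) (b k) :=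
    fun j hj k hk hjk ↦ hdisj j (by simpa using hj) k (by simpa using hk) hjk
  have hle : ∀ k ∈ Finset.range n, a k ≤ b k := fun k hk ↦ (hab k (Finset.mem_range.1 hk)).2.2
  rw [← ENNReal.ofReal_le_ofReal_iff hε.le, ENNReal.ofReal_sum_of_nonneg fun _ _ ↦ dist_nonneg]
  calc ∑ k ∈ Finset.range n, ENNReal.ofReal (dist (γ (a k)) (γ (b k)))
      ≤ ∑ k ∈ Finset.range n, ν (Ioo (a k) (b k)) := Finset.sum_le_sum fun k hk ↦ by
        obtain ⟨ha, hb, hk'⟩ := hab k (Finset.mem_range.1 hk)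
        rw [← edist_dist, measure_congr (hν.ae_le Ioo_ae_eq_Icc)]
        exact (eVariationOn.edist_le γ (left_mem_Icc.2 hk') (right_mem_Icc.2 hk')).trans
          (hγ _ ha _ hb hk')
    _ = ν (⋃ k ∈ Finset.range n, Ioo (a k) (b k)) :=
        (measure_biUnion_finset hd fun _ _ ↦ measurableSet_Ioo).symm
    _ ≤ ENNReal.ofReal ε := by
        refine (H _ (Finset.measurableSet_biUnion _ fun _ _ ↦ measurableSet_Ioo)
          (lt_of_le_of_lt ?_ hηδ.2)).le
        rw [measure_biUnion_finset hd fun _ _ ↦ measurableSet_Ioo]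
        simp_rw [Real.volume_Ioo]
        rw [← ENNReal.ofReal_sum_of_nonneg fun k hk ↦ sub_nonneg.2 (hle k hk)]
        exact ENNReal.ofReal_le_ofReal hsum

/-- Banach–Zaretsky, speed measure version: `γ ∈ AC_loc(I;X)` iff
`γ ∈ BV_loc(I;X)` and its speed measure `ν` is absolutely continuous with respect to
Lebesgue measure. -/
theorem banach_zaretsky_speed_measure {X : Type*} [MetricSpace X]
    (I : Set ℝ) (hI : I.OrdConnected) (γ : ℝ → X) :
    MetricACloc γ I ↔
      ((∀ a ∈ I, ∀ b ∈ I, a ≤ b → eVariationOn γ (Set.Icc a b) < ⊤) ∧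
        ∀ ν : Measure ℝ, IsSpeedMeasure γ I ν →
          ∀ N : Set ℝ, N ⊆ I → MeasurableSet N → volume N = 0 → ν N = 0) := by
  refine ⟨fun h ↦ ⟨fun a ha b hb hab ↦ (h a ha b hb hab).boundedVariationOn.lt_top,
    fun ν hν N hN _ hN0 ↦ h.measure_eq_zero hI hν hN hN0⟩, ?_⟩
  rintro ⟨hBV, hac⟩ a ha b hb hab
  obtain ⟨ν, hν, hle⟩ := exists_isSpeedMeasure hI hBV
  obtain ⟨a', ha', b', hb', hab', U, hU, hUc, habU, hUI⟩ :=
    exists_isOpen_inter_subset_Icc ha hb hab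
  have habI : Icc a b ⊆ I := hI.out ha hb
  have hfin : ν (Icc a b) < ⊤ := by
    refine (measure_mono (subset_inter habU habI)).trans_lt ?_
    rw [hν.2 _ inter_subset_right (hUc.inter hI) ⟨U, hU, rfl⟩]
    exact (eVariationOn.mono γ hUI).trans_lt (hBV a' ha' b' hb' hab')
  have : IsFiniteMeasure (ν.restrict (Icc a b)) := isFiniteMeasure_restrict.2 hfin.ne
  refine metricAC_of_absolutelyContinuous (ν := ν.restrict (Icc a b))
    (Measure.AbsolutelyContinuous.mk fun N hNm hN ↦ ?_) fun s hs t ht _ ↦ ?_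
  · rw [Measure.restrict_apply hNm]
    exact hac ν hν _ (inter_subset_right.trans habI) (hNm.inter measurableSet_Icc)
      (measure_mono_null inter_subset_left hN)
  · have hst : Icc s t ⊆ Icc a b := Icc_subset_Icc hs.1 ht.2
    rw [Measure.restrict_eq_self _ hst]
    exact hle _ (hst.trans habI) ordConnected_Icc
end

section
/- Let γ : I → X. If γ is locally absolutely continuous, then γ is continuous, locally of bounded variation, and has Luzin's property (N). Conversely, if γ is continuous, locally of bounded variation, injective, and has Luzin's property (N), then γ is locally absolutely continuous. -/
open Filter Topology Set MeasureTheory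

/-- `γ` has Luzin's property (N) on `I`: Lebesgue-null subsets of `I` are mapped to
`H¹`-null subsets of `X`. -/
def LuzinN {X : Type*} [MetricSpace X] [MeasurableSpace X] [BorelSpace X]
    (γ : ℝ → X) (I : Set ℝ) : Prop :=
  ∀ N : Set ℝ, N ⊆ I → volume N = 0 → μH[1] (γ '' N) = 0

theorem exists_Icc_mem_nhdsWithin {I : Set ℝ} {x : ℝ} (hx : x ∈ I) :
    ∃ p ∈ I, ∃ q ∈ I, p ≤ x ∧ x ≤ q ∧ Icc p q ∈ 𝓝[I] x := by
  have hl : ∃ p ∈ I, p ≤ x ∧ Ici p ∈ 𝓝[I] x := by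
    by_cases h : ∃ p ∈ I, p < x
    · obtain ⟨p, hp, hpx⟩ := h
      exact ⟨p, hp, hpx.le, mem_nhdsWithin_of_mem_nhds (Ici_mem_nhds hpx)⟩
    · push Not at h
      exact ⟨x, hx, le_rfl, mem_of_superset self_mem_nhdsWithin h⟩
  have hr : ∃ q ∈ I, x ≤ q ∧ Iic q ∈ 𝓝[I] x := by
    by_cases h : ∃ q ∈ I, x < q
    · obtain ⟨q, hq, hxq⟩ := h
      exact ⟨q, hq, hxq.le, mem_nhdsWithin_of_mem_nhds (Iic_mem_nhds hxq)⟩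
    · push Not at h
      exact ⟨x, hx, le_rfl, mem_of_superset self_mem_nhdsWithin h⟩
  obtain ⟨p, hp, hpx, hpn⟩ := hl
  obtain ⟨q, hq, hxq, hqn⟩ := hr
  exact ⟨p, hp, q, hq, hpx, hxq, inter_mem hpn hqn⟩

/-- An open subset of `ℝ` is a countable disjoint union of open intervals. -/
theorem IsOpen.exists_countable_pairwiseDisjoint_ordConnected {U : Set ℝ} (hU : IsOpen U) :
    ∃ C : Set (Set ℝ), C.Countable ∧ C.PairwiseDisjoint id ∧ ⋃₀ C = U ∧
      ∀ J ∈ C, IsOpen J ∧ J.OrdConnected := by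
  have hopen : ∀ J ∈ connectedComponentIn U '' U, IsOpen J := by
    rintro _ ⟨x, -, rfl⟩
    exact hU.connectedComponentIn
  have hdisj : (connectedComponentIn U '' U).PairwiseDisjoint id := by
    rintro _ ⟨x, -, rfl⟩ _ ⟨y, -, rfl⟩ hne
    refine Set.disjoint_left.2 fun z hz hz' ↦ hne ?_
    rw [connectedComponentIn_eq hz, connectedComponentIn_eq hz']
  refine ⟨connectedComponentIn U '' U, ?_, hdisj, ?_, ?_⟩
  · refine hdisj.countable_of_isOpen hopen ?_
    rintro _ ⟨x, hx, rfl⟩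
    exact ⟨x, mem_connectedComponentIn hx⟩
  · refine Subset.antisymm (sUnion_subset ?_) fun x hx ↦
      ⟨_, mem_image_of_mem _ hx, mem_connectedComponentIn hx⟩
    rintro _ ⟨x, -, rfl⟩
    exact connectedComponentIn_subset U x
  · rintro J hJ
    refine ⟨hopen J hJ, ?_⟩
    obtain ⟨x, -, rfl⟩ := hJ
    exact isPreconnected_connectedComponentIn.ordConnected

theorem exists_ediam_image_inter_le {X : Type*} [PseudoEMetricSpace X] {γ : ℝ → X} {a b : ℝ}
    (hab : a ≤ b) (hfin : Metric.ediam (γ '' Icc a b) ≠ ⊤) {J : Set ℝ} (hJ : J.OrdConnected)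
    {η : ENNReal} (hη : η ≠ 0) :
    ∃ x y, x ∈ Icc a b ∧ y ∈ Icc a b ∧ x ≤ y ∧ Ioo x y ⊆ J ∧
      Metric.ediam (γ '' (J ∩ Icc a b)) ≤ edist (γ x) (γ y) + η := by
  rcases (J ∩ Icc a b).eq_empty_or_nonempty with he | ⟨z, hz⟩
  · exact ⟨a, a, left_mem_Icc.2 hab, left_mem_Icc.2 hab, le_rfl, by simp, by simp [he]⟩
  by_contra! hcon
  set D := Metric.ediam (γ '' (J ∩ Icc a b)) with hD
  have key : ∀ x ∈ J ∩ Icc a b, ∀ y ∈ J ∩ Icc a b, edist (γ x) (γ y) + η < D := by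
    intro x hx y hy
    rcases le_total x y with h | h
    · exact hcon x y hx.2 hy.2 h (Ioo_subset_Icc_self.trans (hJ.out hx.1 hy.1))
    · rw [edist_comm]
      exact hcon y x hy.2 hx.2 h (Ioo_subset_Icc_self.trans (hJ.out hy.1 hx.1))
  have hDtop : D ≠ ⊤ := ne_top_of_le_ne_top hfin (Metric.ediam_mono (image_mono inter_subset_right))
  have hD0 : D ≠ 0 := (pos_of_gt (key z hz z hz)).ne'
  refine (ENNReal.sub_lt_self hDtop hD0 hη).not_ge (Metric.ediam_le ?_)
  rintro _ ⟨x, hx, rfl⟩ _ ⟨y, hy, rfl⟩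
  exact ENNReal.le_sub_of_add_le_right (ne_top_of_le_ne_top hDtop
    (le_add_self.trans (key x hx y hy).le)) (key x hx y hy).le

namespace MetricAC

variable {X : Type*} [MetricSpace X] {γ : ℝ → X}

theorem exists_sum_finset_le {S : Set ℝ} (h : MetricAC γ S) {ε : ℝ} (hε : 0 < ε) :
    ∃ δ : ℝ, 0 < δ ∧ ∀ {ι : Type} (s : Finset ι) (a b : ι → ℝ),
      (∀ k ∈ s, a k ∈ S ∧ b k ∈ S ∧ a k ≤ b k) →
      (∀ j ∈ s, ∀ k ∈ s, j ≠ k → Disjoint (Ioo (a j) (b j)) (Ioo (a k) (b k))) →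
      ∑ k ∈ s, (b k - a k) ≤ δ → ∑ k ∈ s, dist (γ (a k)) (γ (b k)) ≤ ε := by
  obtain ⟨δ, hδ, H⟩ := h ε hε
  refine ⟨δ, hδ, fun s a b hab hdisj hsum ↦ ?_⟩
  let e := s.equivFin.symm
  have hs : ∀ f : _ → ℝ, ∑ k ∈ s, f k = ∑ k : Fin s.card, f (e k) := fun f ↦ by
    rw [← Finset.sum_coe_sort, ← e.sum_comp]
  let A : ℕ → ℝ := fun k ↦ if hk : k < s.card then a (e ⟨k, hk⟩) else 0
  let B : ℕ → ℝ := fun k ↦ if hk : k < s.card then b (e ⟨k, hk⟩) else 0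
  have := H s.card A B (fun k hk ↦ by simpa [A, B, hk] using hab _ (e ⟨k, hk⟩).2)
    (fun j hj k hk hjk ↦ by
      simp only [A, B, hj, hk, dif_pos]
      refine hdisj _ (e ⟨j, hj⟩).2 _ (e ⟨k, hk⟩).2 fun h ↦ hjk ?_
      simpa using e.injective (Subtype.ext h))
    (by rw [hs] at hsum; simpa [Finset.sum_range, A, B] using hsum)
  rw [hs]
  simpa [Finset.sum_range, A, B] using this

theorem exists_dist_le {S : Set ℝ} (h : MetricAC γ S) {ε : ℝ} (hε : 0 < ε) :
    ∃ δ : ℝ, 0 < δ ∧ ∀ x ∈ S, ∀ y ∈ S, |x - y| ≤ δ → dist (γ x) (γ y) ≤ ε := by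
  obtain ⟨δ, hδ, H⟩ := h ε hε
  refine ⟨δ, hδ, fun x hx y hy hxy ↦ ?_⟩
  wlog hle : x ≤ y generalizing x y
  · rw [dist_comm]
    exact this y hy x hx (by rwa [abs_sub_comm]) (le_of_not_ge hle)
  have := H 1 (fun _ ↦ x) (fun _ ↦ y) (fun _ _ ↦ ⟨hx, hy, hle⟩)
    (fun j hj k hk hjk ↦ by omega) (by
      simp only [Finset.sum_range_one]
      exact (neg_sub x y ▸ neg_le_abs (x - y)).trans hxy)
  simpa using this

theorem continuousOn {S : Set ℝ} (h : MetricAC γ S) : ContinuousOn γ S := by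
  refine Metric.continuousOn_iff.2 fun x hx ε hε ↦ ?_
  obtain ⟨δ, hδ, H⟩ := h.exists_dist_le (half_pos hε)
  exact ⟨δ, hδ, fun y hy hyx ↦ (H y hy x hx hyx.le).trans_lt (half_lt_self hε)⟩

theorem exists_eVariationOn_le {S : Set ℝ} (h : MetricAC γ S) {ε : ℝ} (hε : 0 < ε) :
    ∃ δ : ℝ, 0 < δ ∧ ∀ c d, Icc c d ⊆ S → d - c ≤ δ →
      eVariationOn γ (Icc c d) ≤ ENNReal.ofReal ε := by
  obtain ⟨δ, hδ, H⟩ := h ε hε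
  refine ⟨δ, hδ, fun c d hcd hlen ↦ iSup_le ?_⟩
  rintro ⟨n, u, hu, hus⟩
  have := H n u (fun k ↦ u (k + 1))
    (fun k _ ↦ ⟨hcd (hus k), hcd (hus (k + 1)), hu k.le_succ⟩)
    (fun j _ k _ hjk ↦ hu.pairwise_disjoint_on_Ioo_succ hjk)
    (by rw [Finset.sum_range_sub]; linarith [(hus 0).1, (hus n).2])
  calc ∑ i ∈ Finset.range n, edist (γ (u (i + 1))) (γ (u i))
      = ENNReal.ofReal (∑ i ∈ Finset.range n, dist (γ (u i)) (γ (u (i + 1)))) := by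
        rw [ENNReal.ofReal_sum_of_nonneg fun _ _ ↦ dist_nonneg]
        simp only [← edist_dist, edist_comm]
    _ ≤ ENNReal.ofReal ε := ENNReal.ofReal_le_ofReal this

theorem eVariationOn_lt_top {a b : ℝ} (h : MetricAC γ (Icc a b)) :
    eVariationOn γ (Icc a b) < ⊤ := by
  obtain ⟨δ, hδ, H⟩ := h.exists_eVariationOn_le one_pos
  have key : ∀ n : ℕ, ∀ d ≤ b, d - a ≤ n * δ → eVariationOn γ (Icc a d) < ⊤ := by
    intro n
    induction n with
    | zero =>
      intro d _ hd
      rw [eVariationOn.subsingleton γ (Set.subsingleton_Icc_of_ge (by simpa using hd))]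
      exact ENNReal.zero_lt_top
    | succ n ih =>
      intro d hdb hd
      rcases le_total a (d - δ) with had | had
      · rw [← univ_inter (Icc a d), ← eVariationOn.Icc_add_Icc γ had (by linarith) (mem_univ _),
          univ_inter, univ_inter]
        refine ENNReal.add_lt_top.2 ⟨ih _ (by linarith) (by push_cast at hd; linarith), ?_⟩
        exact (H _ _ (Icc_subset_Icc had hdb) (by linarith)).trans_lt ENNReal.ofReal_lt_top
      · exact (H a d (Icc_subset_Icc_right hdb) (by linarith)).trans_lt ENNReal.ofReal_lt_top
  obtain ⟨n, hn⟩ := exists_nat_ge ((b - a) / δ)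
  exact key n b le_rfl ((div_le_iff₀ hδ).1 hn)

theorem exists_countable_cover {a b : ℝ} (hab : a ≤ b) (h : MetricAC γ (Icc a b)) {N : Set ℝ}
    (hN : volume N = 0) {ε : ℝ} (hε : 0 < ε) :
    ∃ C : Set (Set ℝ), C.Countable ∧ N ⊆ ⋃₀ C ∧
      ∑' J : C, Metric.ediam (γ '' (J ∩ Icc a b)) ≤ ENNReal.ofReal ε := by
  obtain ⟨δ, hδ, H⟩ := h.exists_sum_finset_le (half_pos hε)
  obtain ⟨U, hNU, hU, hUδ⟩ := Set.exists_isOpen_lt_of_lt N (ENNReal.ofReal δ)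
    (by rw [hN]; exact ENNReal.ofReal_pos.2 hδ)
  obtain ⟨C, hC, hdisj, rfl, hJ⟩ := hU.exists_countable_pairwiseDisjoint_ordConnected
  refine ⟨C, hC, hNU, ENNReal.summable.tsum_le_of_sum_le fun s ↦ ?_⟩
  have hfin : Metric.ediam (γ '' Icc a b) ≠ ⊤ :=
    (isCompact_Icc.image_of_continuousOn h.continuousOn).isBounded.ediam_ne_top
  set η : ℝ := ε / 2 / (s.card + 1) with hη
  have hη0 : 0 < η := by positivity
  choose x y hx hy hxy hsub hle using fun J : C ↦
    exists_ediam_image_inter_le hab hfin (hJ J J.2).2 (ENNReal.ofReal_pos.2 hη0).ne'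
  have hdisjC : Pairwise (Function.onFun Disjoint fun J : C ↦ (J : Set ℝ)) :=
    fun J K hJK ↦ hdisj J.2 K.2 (Subtype.coe_injective.ne hJK)
  have hlen : ∑ J ∈ s, (y J - x J) ≤ δ := by
    rw [← ENNReal.ofReal_le_ofReal_iff hδ.le,
      ENNReal.ofReal_sum_of_nonneg fun J _ ↦ sub_nonneg.2 (hxy J)]
    have := hC.to_subtype
    calc ∑ J ∈ s, ENNReal.ofReal (y J - x J)
        ≤ ∑ J ∈ s, volume (J : Set ℝ) := Finset.sum_le_sum fun J _ ↦ by
          rw [← Real.volume_Ioo]; exact measure_mono (hsub J)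
      _ ≤ ∑' J : C, volume (J : Set ℝ) := ENNReal.sum_le_tsum s
      _ ≤ volume (⋃ J : C, (J : Set ℝ)) :=
          tsum_meas_le_meas_iUnion_of_disjoint _ (fun J ↦ (hJ J J.2).1.measurableSet) hdisjC
      _ ≤ ENNReal.ofReal δ := by rw [← sUnion_eq_iUnion]; exact hUδ.le
  have hdist := H s x y (fun J _ ↦ ⟨hx J, hy J, hxy J⟩)
    (fun J _ K _ hJK ↦ (hdisjC hJK).mono (hsub J) (hsub K)) hlen
  calc ∑ J ∈ s, Metric.ediam (γ '' (J ∩ Icc a b))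
      ≤ ∑ J ∈ s, ENNReal.ofReal (dist (γ (x J)) (γ (y J)) + η) :=
        Finset.sum_le_sum fun J _ ↦ by
          rw [ENNReal.ofReal_add dist_nonneg hη0.le, ← edist_dist]; exact hle J
    _ = ENNReal.ofReal (∑ J ∈ s, dist (γ (x J)) (γ (y J)) + s.card * η) := by
        rw [← ENNReal.ofReal_sum_of_nonneg fun _ _ ↦ by positivity, Finset.sum_add_distrib]
        simp
    _ ≤ ENNReal.ofReal ε := by
        refine ENNReal.ofReal_le_ofReal ?_
        have : s.card * η ≤ ε / 2 := by
          rw [hη, mul_div_assoc', div_le_iff₀ (by positivity)]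
          nlinarith
        linarith

theorem luzinN_Icc [MeasurableSpace X] [BorelSpace X] {a b : ℝ} (hab : a ≤ b)
    (h : MetricAC γ (Icc a b)) : LuzinN γ (Icc a b) := by
  intro N hNS hN
  have hpos : ∀ n : ℕ, (0 : ℝ) < 1 / (n + 1) := fun n ↦ by positivity
  choose C hC hNC hsum using fun n : ℕ ↦ h.exists_countable_cover hab hN (hpos n)
  have hr : Tendsto (fun n : ℕ ↦ ENNReal.ofReal (1 / (n + 1))) atTop (𝓝 0) := by
    simpa using ENNReal.tendsto_ofReal tendsto_one_div_add_atTop_nhds_zero_nat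
  have : ∀ n, Countable (C n) := fun n ↦ (hC n).to_subtype
  refine nonpos_iff_eq_zero.1 ((Measure.hausdorffMeasure_le_liminf_tsum 1 (γ '' N) _ hr
    (fun n (J : C n) ↦ γ '' (J ∩ Icc a b))
    (Eventually.of_forall fun n J ↦ (ENNReal.le_tsum J).trans (hsum n))
    (Eventually.of_forall fun n ↦ ?_)).trans ?_)
  · rintro _ ⟨x, hx, rfl⟩
    obtain ⟨J, hJ, hxJ⟩ := hNC n hx
    exact mem_iUnion.2 ⟨⟨J, hJ⟩, mem_image_of_mem γ ⟨hxJ, hNS hx⟩⟩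
  · rw [← hr.liminf_eq]
    exact liminf_le_liminf (Eventually.of_forall fun n ↦ by simpa using hsum n)

end MetricAC

section HausdorffMeasure

variable {X : Type*} [MetricSpace X] [MeasurableSpace X] [BorelSpace X] {γ : ℝ → X}

theorem hausdorffMeasure_image_le_eVariationOn {a b : ℝ} (hab : a ≤ b)
    (h : eVariationOn γ (Icc a b) ≠ ⊤) :
    μH[1] (γ '' Icc a b) ≤ eVariationOn γ (Icc a b) := by
  have hloc : LocallyBoundedVariationOn γ (Icc a b) :=
    BoundedVariationOn.locallyBoundedVariationOn h
  have ha : a ∈ Icc a b := left_mem_Icc.2 hab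
  have hb : b ∈ Icc a b := right_mem_Icc.2 hab
  set V := variationOnFromTo γ (Icc a b) a with hV
  set g := naturalParameterization γ (Icc a b) a
  have hspeed : HasUnitSpeedOn g (V '' Icc a b) := has_unit_speed_naturalParameterization γ hloc ha
  have hlip : LipschitzOnWith 1 g (V '' Icc a b) := by
    intro x hx y hy
    wlog hxy : x ≤ y generalizing x y
    · rw [edist_comm, edist_comm x]
      exact this hy hx (le_of_not_ge hxy)
    calc edist (g x) (g y) ≤ eVariationOn g (V '' Icc a b ∩ Icc x y) :=
          eVariationOn.edist_le g ⟨hx, left_mem_Icc.2 hxy⟩ ⟨hy, right_mem_Icc.2 hxy⟩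
      _ = ENNReal.ofReal (y - x) := by simpa using hspeed hx hy
      _ = (1 : NNReal) * edist x y := by
          rw [edist_comm, edist_dist, Real.dist_eq, abs_of_nonneg (sub_nonneg.2 hxy)]; simp
  have himage : γ '' Icc a b ⊆ g '' (V '' Icc a b) := by
    rintro _ ⟨t, ht, rfl⟩
    exact ⟨V t, mem_image_of_mem V ht,
      edist_eq_zero.1 (edist_naturalParameterization_eq_zero hloc ha ht)⟩
  have hrange : V '' Icc a b ⊆ Icc 0 (V b) := by
    rintro _ ⟨t, ht, rfl⟩
    exact ⟨variationOnFromTo.nonneg_of_le _ _ ht.1,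
      variationOnFromTo.monotoneOn hloc ha ht hb ht.2⟩
  calc μH[1] (γ '' Icc a b) ≤ μH[1] (g '' (V '' Icc a b)) := measure_mono himage
    _ ≤ μH[1] (V '' Icc a b) := by simpa using hlip.hausdorffMeasure_image_le zero_le_one
    _ ≤ volume (Icc 0 (V b)) := by
        rw [hausdorffMeasure_real]; exact measure_mono hrange
    _ = eVariationOn γ (Icc a b) := by
        rw [Real.volume_Icc, sub_zero, hV, variationOnFromTo.eq_of_le _ _ hab, inter_self,
          ENNReal.ofReal_toReal h]

theorem edist_le_hausdorffMeasure_image_Ioo {s t : ℝ} (hst : s ≤ t)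
    (hγ : ContinuousOn γ (Icc s t)) : edist (γ s) (γ t) ≤ μH[1] (γ '' Ioo s t) := by
  have hlip : LipschitzWith 1 (dist (γ s)) := LipschitzWith.dist_right _
  have hsub : Icc 0 (dist (γ s) (γ t)) ⊆ dist (γ s) '' (γ '' Icc s t) := by
    rw [image_image]
    simpa using intermediate_value_Icc hst (hlip.continuous.comp_continuousOn hγ)
  have := Measure.nullSingletonClass_hausdorff X one_pos
  calc edist (γ s) (γ t) = μH[1] (Icc 0 (dist (γ s) (γ t))) := by
        rw [hausdorffMeasure_real, Real.volume_Icc, sub_zero, edist_dist]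
    _ ≤ μH[1] (dist (γ s) '' (γ '' Icc s t)) := measure_mono hsub
    _ ≤ μH[1] (γ '' Icc s t) := by simpa using hlip.hausdorffMeasure_image_le zero_le_one _
    _ ≤ μH[1] (γ '' Ioo s t) + μH[1] (γ '' {s, t}) := by
        rw [← Ioo_union_both hst, image_union]; exact measure_union_le _ _
    _ = μH[1] (γ '' Ioo s t) := by
        rw [((toFinite {s, t}).image γ).measure_zero, add_zero]

theorem MeasureTheory.Measure.AbsolutelyContinuous.exists_pos_forall_measure_lt {α : Type*}
    [MeasurableSpace α] {μ ν : Measure α} [SigmaFinite μ] [IsFiniteMeasure ν] (h : ν ≪ μ)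
    {ε : ENNReal} (hε : ε ≠ 0) : ∃ δ > 0, ∀ s, MeasurableSet s → μ s < δ → ν s < ε := by
  obtain ⟨δ, hδ, H⟩ := exists_pos_setLIntegral_lt_of_measure_lt
    (Measure.lintegral_rnDeriv_lt_top ν μ).ne hε
  refine ⟨δ, hδ, fun s hs hsδ ↦ ?_⟩
  rw [← Measure.withDensity_rnDeriv_eq ν μ h, withDensity_apply _ hs]
  exact H s hsδ

theorem LuzinN.metricAC_Icc {a b : ℝ} (hab : a ≤ b) (hN : LuzinN γ (Icc a b))
    (hγ : ContinuousOn γ (Icc a b)) (hinj : InjOn γ (Icc a b))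
    (hvar : eVariationOn γ (Icc a b) ≠ ⊤) : MetricAC γ (Icc a b) := by
  set S := Icc a b with hS
  have hemb : MeasurableEmbedding (S.domRestrict γ) := hγ.measurableEmbedding measurableSet_Icc hinj
  let ν : Measure ℝ := (Measure.comap (S.domRestrict γ) μH[1]).map Subtype.val
  have hν : ∀ A, MeasurableSet A → ν A = μH[1] (γ '' (A ∩ S)) := by
    intro A hA
    rw [Measure.map_apply measurable_subtype_coe hA, hemb.comap_apply]
    congr 1
    ext z
    constructor
    · rintro ⟨x, hx, rfl⟩
      exact ⟨x, ⟨hx, x.2⟩, rfl⟩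
    · rintro ⟨x, hx, rfl⟩
      exact ⟨⟨x, hx.2⟩, hx.1, rfl⟩
  have : IsFiniteMeasure ν := ⟨by
    rw [hν _ MeasurableSet.univ, univ_inter]
    exact (hausdorffMeasure_image_le_eVariationOn hab hvar).trans_lt hvar.lt_top⟩
  have hac : ν ≪ volume := Measure.AbsolutelyContinuous.mk fun A hA hA0 ↦ by
    rw [hν A hA]
    exact hN _ inter_subset_right (measure_mono_null inter_subset_left hA0)
  intro ε hε
  obtain ⟨δ, hδ, H⟩ := hac.exists_pos_forall_measure_lt (ENNReal.ofReal_pos.2 hε).ne'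
  obtain ⟨δ', hδ', hδδ⟩ := ENNReal.lt_iff_exists_nnreal_btwn.1 hδ
  refine ⟨δ', by exact_mod_cast hδ', fun n u v huv hdisj hsum ↦ ?_⟩
  rw [← ENNReal.ofReal_le_ofReal_iff hε.le, ENNReal.ofReal_sum_of_nonneg fun _ _ ↦ dist_nonneg]
  have huvS : ∀ k < n, Icc (u k) (v k) ⊆ S := fun k hk ↦
    Icc_subset_Icc (huv k hk).1.1 (huv k hk).2.1.2
  calc ∑ k ∈ Finset.range n, ENNReal.ofReal (dist (γ (u k)) (γ (v k)))
      ≤ ∑ k ∈ Finset.range n, ν (Ioo (u k) (v k)) := Finset.sum_le_sum fun k hk ↦ by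
        have hk := Finset.mem_range.1 hk
        rw [hν _ measurableSet_Ioo, ← edist_dist,
          inter_eq_self_of_subset_left (Ioo_subset_Icc_self.trans (huvS k hk))]
        exact edist_le_hausdorffMeasure_image_Ioo (huv k hk).2.2 (hγ.mono (huvS k hk))
    _ = ν (⋃ k ∈ Finset.range n, Ioo (u k) (v k)) :=
        (measure_biUnion_finset (fun j hj k hk hjk ↦ hdisj j (Finset.mem_range.1 hj) k
          (Finset.mem_range.1 hk) hjk) fun _ _ ↦ measurableSet_Ioo).symm
    _ ≤ ENNReal.ofReal ε := by
        refine (H _ (Finset.measurableSet_biUnion _ fun _ _ ↦ measurableSet_Ioo) ?_).le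
        calc volume (⋃ k ∈ Finset.range n, Ioo (u k) (v k))
            ≤ ∑ k ∈ Finset.range n, volume (Ioo (u k) (v k)) := measure_biUnion_finset_le _ _
          _ = ENNReal.ofReal (∑ k ∈ Finset.range n, (v k - u k)) := by
              rw [ENNReal.ofReal_sum_of_nonneg fun k hk ↦
                sub_nonneg.2 (huv k (Finset.mem_range.1 hk)).2.2]
              simp only [Real.volume_Ioo]
          _ ≤ δ' := by
              rw [← ENNReal.ofReal_coe_nnreal]; exact ENNReal.ofReal_le_ofReal hsum
          _ < δ := hδδ

end HausdorffMeasure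

/-- If `γ ∈ AC_loc(I;X)` then `γ` is continuous, locally of bounded
variation and has Luzin's property (N); conversely, if `γ` is continuous, locally of
bounded variation, injective and has property (N), then `γ ∈ AC_loc(I;X)`. -/
theorem ac_loc_luzin {X : Type*} [MetricSpace X] [MeasurableSpace X] [BorelSpace X]
    (I : Set ℝ) (hI : I.OrdConnected) (γ : ℝ → X) :
    (MetricACloc γ I →
      ContinuousOn γ I ∧
      (∀ a ∈ I, ∀ b ∈ I, a ≤ b → eVariationOn γ (Set.Icc a b) < ⊤) ∧
      LuzinN γ I) ∧
    ((ContinuousOn γ I ∧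
      (∀ a ∈ I, ∀ b ∈ I, a ≤ b → eVariationOn γ (Set.Icc a b) < ⊤) ∧
      Set.InjOn γ I ∧ LuzinN γ I) → MetricACloc γ I) := by
  refine ⟨fun h ↦ ⟨fun x hx ↦ ?_, fun a ha b hb hab ↦ (h a ha b hb hab).eVariationOn_lt_top,
    fun N hNI hN ↦ ?_⟩, fun ⟨hγ, hvar, hinj, hN⟩ a ha b hb hab ↦ ?_⟩
  · obtain ⟨p, hp, q, hq, hpx, hxq, hpq⟩ := exists_Icc_mem_nhdsWithin hx
    exact ((h p hp q hq (hpx.trans hxq)).continuousOn x ⟨hpx, hxq⟩).mono_of_mem_nhdsWithin hpq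
  · let m : OuterMeasure ℝ := OuterMeasure.comap γ (μH[1] : Measure X).toOuterMeasure
    refine measure_null_of_locally_null (μ := m) N fun x hx ↦ ?_
    obtain ⟨p, hp, q, hq, hpx, hxq, hpq⟩ := exists_Icc_mem_nhdsWithin (hNI hx)
    exact ⟨N ∩ Icc p q, inter_mem self_mem_nhdsWithin (nhdsWithin_mono x hNI hpq),
      (h p hp q hq (hpx.trans hxq)).luzinN_Icc (hpx.trans hxq) _ inter_subset_right
        (measure_mono_null inter_subset_left hN)⟩
  · have hsub : Icc a b ⊆ I := hI.out ha hb
    exact LuzinN.metricAC_Icc hab (fun N hNS ↦ hN N (hNS.trans hsub)) (hγ.mono hsub)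
      (hinj.mono hsub) (hvar a ha b hb hab).ne
end

section
/- Let γ : I → X be locally of bounded variation with speed measure ν, and let ν = ν_ac + ν_sing be the Lebesgue decomposition of ν with respect to Lebesgue measure λ (ν_ac ≪ λ, ν_sing ⟂ λ). Then the metric derivative |γ̇|(t) = lim_{ε→0} d(γ(t+ε),γ(t))/|ε| exists for λ-almost every t ∈ I and ν_ac = |γ̇| · λ, i.e. |γ̇| is a Radon–Nikodým derivative of ν_ac with respect to λ. -/
open Filter Topology Set MeasureTheory

/-- The length of the restriction to `(-∞, s]` of the polygonal path inscribed in `γ` with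
vertices `u 0, …, u n`, where the final vertex is replaced by `s`. -/
noncomputable def inscribedLength {X : Type*} [MetricSpace X] (γ : ℝ → X) (u : ℕ → ℝ) (n : ℕ)
    (s : ℝ) : ℝ :=
  ∑ i ∈ Finset.range n, dist (γ (u i)) (γ (max (u i) (min (u (i + 1)) s)))

section InscribedLength

variable {X : Type*} [MetricSpace X] {γ : ℝ → X} {u : ℕ → ℝ}

theorem inscribedLength_succ (n : ℕ) (s : ℝ) :
    inscribedLength γ u (n + 1) s =
      inscribedLength γ u n s + dist (γ (u n)) (γ (max (u n) (min (u (n + 1)) s))) :=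
  Finset.sum_range_succ _ _

theorem inscribedLength_of_le (hu : Monotone u) {n : ℕ} {s : ℝ} (hs : s ≤ u 0) :
    inscribedLength γ u n s = 0 := by
  refine Finset.sum_eq_zero fun i _ => ?_
  rw [max_eq_left, dist_self]
  exact (min_le_right _ _).trans (hs.trans (hu (Nat.zero_le i)))

theorem inscribedLength_of_ge (hu : Monotone u) {n : ℕ} {s : ℝ} (hs : u n ≤ s) :
    inscribedLength γ u n s = ∑ i ∈ Finset.range n, dist (γ (u i)) (γ (u (i + 1))) := by
  refine Finset.sum_congr rfl fun i hi => ?_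
  have h : u (i + 1) ≤ s := (hu (Finset.mem_range.1 hi)).trans hs
  rw [min_eq_left h, max_eq_right (hu i.le_succ)]

theorem apply_clamp_sub {V : ℝ → ℝ} {p q : ℝ} (hpq : p ≤ q) (s : ℝ) :
    V (max p (min q s)) = V (min q s) - V (min p s) + V p := by
  rcases le_total s p with h | h
  · rw [min_eq_right h, min_eq_right (h.trans hpq), max_eq_left h]; ring
  · rw [min_eq_left h, max_eq_right (le_min hpq h)]; ring

theorem inscribedLength_sub_le {S : Set ℝ} [hS : S.OrdConnected] {V : ℝ → ℝ} (hV : Monotone V)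
    (hγV : ∀ x ∈ S, ∀ y ∈ S, x ≤ y → dist (γ x) (γ y) ≤ V y - V x)
    (hu : Monotone u) (huS : ∀ i, u i ∈ S) (n : ℕ) {s t : ℝ} (hst : s ≤ t) :
    inscribedLength γ u n t - inscribedLength γ u n s ≤ V t - V s := by
  have key : inscribedLength γ u n t - inscribedLength γ u n s ≤
      (V (min (u n) t) - V (min (u 0) t)) - (V (min (u n) s) - V (min (u 0) s)) := by
    induction n with
    | zero => simp [inscribedLength]
    | succ n ih =>
      have hn : u n ≤ u (n + 1) := hu n.le_succ
      have hmem : ∀ r, max (u n) (min (u (n + 1)) r) ∈ S := fun r =>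
        hS.out (huS n) (huS (n + 1)) ⟨le_max_left _ _, max_le hn (min_le_left _ _)⟩
      have h1 := hγV _ (hmem s) _ (hmem t) (max_le_max le_rfl (min_le_min le_rfl hst))
      have h2 := dist_triangle (γ (u n)) (γ (max (u n) (min (u (n + 1)) s)))
        (γ (max (u n) (min (u (n + 1)) t)))
      rw [apply_clamp_sub (V := V) hn, apply_clamp_sub (V := V) hn] at h1
      rw [inscribedLength_succ, inscribedLength_succ]
      linarith
  have h0 : V (min (u 0) s) ≤ V (min (u 0) t) := hV (min_le_min le_rfl hst)
  have h1 : V (min (u n) t) - V (min (u n) s) ≤ V t - V s := by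
    rcases le_total (u n) s with h | h
    · rw [min_eq_left h, min_eq_left (h.trans hst), sub_self]
      exact sub_nonneg.2 (hV hst)
    · rw [min_eq_right h]
      exact sub_le_sub_right (hV (min_le_right _ _)) _
  linarith

theorem eventually_abs_inscribedLength_sub_le (hu : Monotone u) (n : ℕ) {t : ℝ}
    (ht : ∀ i, t ≠ u i) :
    ∀ᶠ s in 𝓝 t, |inscribedLength γ u n s - inscribedLength γ u n t| ≤ dist (γ s) (γ t) := by
  suffices h : (∀ᶠ s in 𝓝 t, |inscribedLength γ u n s - inscribedLength γ u n t| ≤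
      dist (γ s) (γ t)) ∧ (u n < t → ∀ᶠ s in 𝓝 t,
        inscribedLength γ u n s = inscribedLength γ u n t) from h.1
  induction n with
  | zero => simp [inscribedLength]
  | succ n ih =>
    have hn : u n ≤ u (n + 1) := hu n.le_succ
    rcases lt_or_gt_of_ne (ht n) with h | h
    · refine ⟨?_, fun h' => absurd (hn.trans_lt h') h.not_gt⟩
      filter_upwards [ih.1, Iio_mem_nhds h] with s hs hsn
      rw [inscribedLength_succ, inscribedLength_succ,
        max_eq_left ((min_le_right _ _).trans (le_of_lt hsn)),
        max_eq_left ((min_le_right _ _).trans h.le)]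
      simpa using hs
    · rcases lt_or_gt_of_ne (ht (n + 1)) with h' | h'
      · refine ⟨?_, fun h'' => absurd h'' h'.not_gt⟩
        filter_upwards [ih.2 h, Ioo_mem_nhds h h'] with s hs hsn
        rw [inscribedLength_succ, inscribedLength_succ, hs, min_eq_right hsn.2.le,
          min_eq_right h'.le, max_eq_right hsn.1.le, max_eq_right h.le, add_sub_add_left_eq_sub,
          dist_comm (γ (u n)), dist_comm (γ (u n))]
        exact abs_dist_sub_le _ _ _
      · have : ∀ᶠ s in 𝓝 t, inscribedLength γ u (n + 1) s = inscribedLength γ u (n + 1) t := by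
          filter_upwards [ih.2 h, Ioi_mem_nhds h'] with s hs hsn
          rw [inscribedLength_succ, inscribedLength_succ, hs, min_eq_left (le_of_lt hsn),
            min_eq_left h'.le]
        refine ⟨?_, fun _ => this⟩
        filter_upwards [this] with s hs
        simp [hs]

end InscribedLength

section MonotoneDerivative

/-- A sequence of monotone functions with total increments tending to zero has, at almost every
point, derivatives that come arbitrarily close to zero. -/
theorem ae_exists_hasDerivAt_lt_of_increments_tendsto_zero {h : ℕ → ℝ → ℝ} {ε : ℕ → ℝ}
    (hmono : ∀ n, Monotone (h n)) (hε : Tendsto ε atTop (𝓝 0))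
    (hinc : ∀ n x y, h n y - h n x ≤ ε n) :
    ∀ᵐ t : ℝ, ∀ η > 0, ∃ n, ∃ w < η, HasDerivAt (h n) w t := by
  set r : ℕ → ℝ → ENNReal := fun n =>
    (hmono n).stieltjesFunction.measure.rnDeriv volume
  have hint : ∀ n, ∫⁻ t, r n t ≤ ENNReal.ofReal (ε n) := by
    intro n
    refine Measure.lintegral_rnDeriv_le.trans ?_
    have hU : ⋃ k : ℕ, Ioc (-(k : ℝ)) k = univ := by
      refine eq_univ_of_forall fun x => mem_iUnion.2 ?_
      obtain ⟨k, hk⟩ := exists_nat_gt |x|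
      exact ⟨k, (abs_lt.1 hk).1, (abs_lt.1 hk).2.le⟩
    have hm : Monotone fun k : ℕ => Ioc (-(k : ℝ)) k := fun i j hij =>
      Ioc_subset_Ioc (by simpa using hij) (by simpa using hij)
    rw [← hU]
    refine le_of_tendsto' (tendsto_measure_iUnion_atTop hm) fun k => ?_
    rw [Function.comp_apply, StieltjesFunction.measure_Ioc, Monotone.stieltjesFunction_eq,
      Monotone.stieltjesFunction_eq]
    refine ENNReal.ofReal_le_ofReal (le_trans ?_ (hinc n (-(k : ℝ)) (k + 1)))
    exact sub_le_sub ((hmono n).rightLim_le (by linarith)) ((hmono n).le_rightLim le_rfl)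
  have hzero : ∫⁻ t, ⨅ n, r n t = 0 := by
    refine le_antisymm ?_ bot_le
    have h0 : Tendsto (fun n => ENNReal.ofReal (ε n)) atTop (𝓝 0) := by
      simpa [Function.comp_def] using (ENNReal.continuous_ofReal.tendsto 0).comp hε
    exact ge_of_tendsto' h0 fun n => (lintegral_mono fun t => iInf_le _ n).trans (hint n)
  rw [lintegral_eq_zero_iff (Measurable.iInf fun n => Measure.measurable_rnDeriv _ _)] at hzero
  filter_upwards [hzero, ae_all_iff.2 fun n => (hmono n).ae_hasDerivAt] with t h0 hd η hη
  have : ⨅ n, r n t < ENNReal.ofReal η := by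
    rw [h0]; exact ENNReal.ofReal_pos.2 hη
  obtain ⟨n, hn⟩ := iInf_lt_iff.1 this
  exact ⟨n, _, ENNReal.toReal_lt_of_lt_ofReal hn, hd n⟩

/-- A monotone function squeezed between the left- and right-continuous distribution functions of a
finite measure is differentiable almost everywhere, its derivative being the density of the
measure. -/
theorem Monotone.ae_hasDerivAt_rnDeriv_of_measure_le {V : ℝ → ℝ} (hV : Monotone V)
    {μ : Measure ℝ} [IsFiniteMeasure μ] (hlow : ∀ t, μ.real (Iio t) ≤ V t)
    (hup : ∀ t, V t ≤ μ.real (Iic t)) :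
    ∀ᵐ t, HasDerivAt V (μ.rnDeriv volume t).toReal t := by
  have hlim : ∀ t, hV.stieltjesFunction t = μ.real (Iic t) := by
    intro t
    rw [Monotone.stieltjesFunction_eq]
    refine rightLim_eq_of_tendsto ?_
    have hI : Tendsto (fun s => μ.real (Iic s)) (𝓝[>] t) (𝓝 (μ.real (Iic t))) := by
      have h := tendsto_measure_biInter_gt (μ := μ) (s := fun s : ℝ => Iic s) (a := t)
        (fun _ _ => measurableSet_Iic.nullMeasurableSet) (fun _ _ _ hij => Iic_subset_Iic.2 hij)
        ⟨t + 1, by simp, measure_ne_top _ _⟩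
      have hset : ⋂ r > t, Iic r = Iic t := by
        ext x
        simp only [mem_iInter, mem_Iic]
        exact ⟨fun hx => le_of_forall_gt_imp_ge_of_dense hx, fun hx r hr => hx.trans hr.le⟩
      rw [hset] at h
      exact (ENNReal.tendsto_toReal (measure_ne_top _ _)).comp h
    refine tendsto_of_tendsto_of_tendsto_of_le_of_le' tendsto_const_nhds hI ?_
      (Eventually.of_forall hup)
    filter_upwards [self_mem_nhdsWithin] with s hs
    exact (measureReal_mono (Iic_subset_Iio.2 hs)).trans (hlow s)
  have hμ : hV.stieltjesFunction.measure = μ := by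
    refine Measure.ext_of_Ioc _ _ fun x y hxy => ?_
    rw [StieltjesFunction.measure_Ioc, hlim, hlim, ← Iic_sdiff_Iic,
      ← measureReal_sdiff (Iic_subset_Iic.2 hxy.le) measurableSet_Iic, ofReal_measureReal]
  have h := hV.ae_hasDerivAt
  rwa [hμ] at h

end MonotoneDerivative

section Variation

variable {X : Type*} [MetricSpace X] {γ : ℝ → X}

theorem exists_eVariationOn_le_sum_add {S : Set ℝ} (hS : S.Nonempty)
    (hfin : eVariationOn γ S ≠ ⊤) {ε : ℝ} (hε : 0 < ε) :
    ∃ (n : ℕ) (u : ℕ → ℝ), Monotone u ∧ (∀ i, u i ∈ S) ∧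
      (eVariationOn γ S).toReal ≤
        (∑ i ∈ Finset.range n, dist (γ (u i)) (γ (u (i + 1)))) + ε := by
  have : Nonempty {u : ℕ → ℝ // Monotone u ∧ ∀ i, u i ∈ S} :=
    eVariationOn.nonempty_monotone_mem hS
  by_contra! hcon
  have key : eVariationOn γ S + ENNReal.ofReal ε ≤ eVariationOn γ S := by
    nth_rewrite 1 [eVariationOn]
    rw [ENNReal.iSup_add]
    refine iSup_le fun p => ?_
    have h := hcon p.1 p.2.1 p.2.2.1 p.2.2.2
    have hsum : ∑ i ∈ Finset.range p.1, edist (γ (p.2.1 (i + 1))) (γ (p.2.1 i)) =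
        ENNReal.ofReal (∑ i ∈ Finset.range p.1, dist (γ (p.2.1 i)) (γ (p.2.1 (i + 1)))) := by
      rw [ENNReal.ofReal_sum_of_nonneg fun _ _ => dist_nonneg]
      exact Finset.sum_congr rfl fun i _ => by rw [edist_dist, dist_comm]
    rw [hsum, ← ENNReal.ofReal_add (Finset.sum_nonneg fun _ _ => dist_nonneg) hε.le]
    exact ENNReal.ofReal_le_of_le_toReal h.le
  exact (ENNReal.lt_add_right hfin (ENNReal.ofReal_pos.2 hε).ne').not_ge key

theorem dist_le_eVariationOn_inter_Iic_sub {S : Set ℝ} (hfin : eVariationOn γ S ≠ ⊤) {x y : ℝ}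
    (hx : x ∈ S) (hy : y ∈ S) (hxy : x ≤ y) :
    dist (γ x) (γ y) ≤
      (eVariationOn γ (S ∩ Iic y)).toReal - (eVariationOn γ (S ∩ Iic x)).toReal := by
  have hne : ∀ z, eVariationOn γ (S ∩ Iic z) ≠ ⊤ := fun z =>
    ((eVariationOn.mono γ inter_subset_left).trans_lt hfin.lt_top).ne
  have h : eVariationOn γ (S ∩ Iic x) + eVariationOn γ {x, y} ≤ eVariationOn γ (S ∩ Iic y) := by
    refine (eVariationOn.add_le_union γ ?_).trans (eVariationOn.mono γ ?_)
    · rintro z ⟨-, hz⟩ w (rfl | rfl)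
      exacts [hz, le_trans hz hxy]
    · rintro z (⟨hz, hzx⟩ | rfl | rfl)
      exacts [⟨hz, le_trans hzx hxy⟩, ⟨hx, hxy⟩, ⟨hy, mem_Iic.2 le_rfl⟩]
  rw [eVariationOn.pair] at h
  have h' := ENNReal.toReal_mono (hne y) h
  rw [ENNReal.toReal_add (hne x) (edist_ne_top _ _), edist_dist,
    ENNReal.toReal_ofReal dist_nonneg] at h'
  linarith

/-- A difference quotient that is dominated by that of `V`, and dominates those of `f` for
functions `f` with derivative arbitrarily close to that of `V`, converges to the derivative
of `V`. -/
theorem tendsto_dist_div_of_hasDerivAt {V : ℝ → ℝ} {v t : ℝ} (hV : HasDerivAt V v t)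
    (hup : ∀ᶠ s in 𝓝 t, dist (γ s) (γ t) ≤ |V s - V t|)
    (hV0 : Monotone V)
    (hlow : ∀ η > 0, ∃ (f : ℝ → ℝ) (w : ℝ), v - η < w ∧ HasDerivAt f w t ∧
      ∀ᶠ s in 𝓝 t, |f s - f t| ≤ dist (γ s) (γ t)) :
    Tendsto (fun s => dist (γ s) (γ t) / |s - t|) (𝓝[≠] t) (𝓝 v) := by
  refine tendsto_order.2 ⟨fun c hc => ?_, fun c hc => ?_⟩
  · obtain ⟨f, w, hw, hf, hle⟩ := hlow (v - c) (by linarith)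
    have hcw : c < w := by linarith
    filter_upwards [hf.tendsto_slope.eventually (lt_mem_nhds hcw), nhdsWithin_le_nhds hle]
      with s hs hsle
    refine hs.trans_le ?_
    rw [slope_def_field]
    refine (le_abs_self _).trans ?_
    rw [abs_div]
    exact div_le_div_of_nonneg_right hsle (abs_nonneg _)
  · filter_upwards [hV.tendsto_slope.eventually (gt_mem_nhds hc), nhdsWithin_le_nhds hup,
      self_mem_nhdsWithin] with s hs hsle hst
    refine lt_of_le_of_lt ?_ hs
    have hnonneg : 0 ≤ slope V t s := by
      rw [slope_def_field]
      rcases le_total t s with h | h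
      · exact div_nonneg (sub_nonneg.2 (hV0 h)) (sub_nonneg.2 h)
      · exact div_nonneg_of_nonpos (sub_nonpos.2 (hV0 h)) (sub_nonpos.2 h)
    rw [← abs_of_nonneg hnonneg, slope_def_field, abs_div]
    exact div_le_div_of_nonneg_right hsle (abs_nonneg _)

theorem ae_tendsto_dist_div_of_mem_Ioo {a b : ℝ} {ν : Measure ℝ}
    (hfin : eVariationOn γ (Ioo a b) ≠ ⊤)
    (hν : ∀ J ⊆ Ioo a b, J.OrdConnected → IsOpen J → ν J = eVariationOn γ J) :
    ∀ᵐ t, t ∈ Ioo a b → Tendsto (fun s => dist (γ s) (γ t) / |s - t|) (𝓝[≠] t)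
      (𝓝 ((ν.restrict (Ioo a b)).rnDeriv volume t).toReal) := by
  rcases (Ioo a b).eq_empty_or_nonempty with hempty | hne
  · simp [hempty]
  set μ := ν.restrict (Ioo a b) with hμ
  have hνfin : ν (Ioo a b) ≠ ⊤ := by rwa [hν _ subset_rfl ordConnected_Ioo isOpen_Ioo]
  have : IsFiniteMeasure μ := ⟨by rw [hμ, Measure.restrict_apply_univ]; exact hνfin.lt_top⟩
  have hle : ∀ {S}, S ⊆ Ioo a b → eVariationOn γ S ≠ ⊤ := fun hS =>
    ((eVariationOn.mono γ hS).trans_lt hfin.lt_top).ne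
  set V : ℝ → ℝ := fun t => (eVariationOn γ (Ioo a b ∩ Iic t)).toReal
  have hVmono : Monotone V := fun s t hst => ENNReal.toReal_mono (hle inter_subset_left)
    (eVariationOn.mono γ (inter_subset_inter_right _ (Iic_subset_Iic.2 hst)))
  have hdist : ∀ x ∈ Ioo a b, ∀ y ∈ Ioo a b, x ≤ y → dist (γ x) (γ y) ≤ V y - V x :=
    fun x hx y hy hxy => dist_le_eVariationOn_inter_Iic_sub hfin hx hy hxy
  have hVle : ∀ t, V t ≤ (eVariationOn γ (Ioo a b)).toReal := fun t =>
    ENNReal.toReal_mono hfin (eVariationOn.mono γ inter_subset_left)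
  have hIio : ∀ t, μ.real (Iio t) = (eVariationOn γ (Ioo a b ∩ Iio t)).toReal := by
    intro t
    rw [measureReal_def, hμ, Measure.restrict_apply measurableSet_Iio, inter_comm,
      hν _ inter_subset_left (ordConnected_Ioo.inter ordConnected_Iio)
        (isOpen_Ioo.inter isOpen_Iio)]
  have hlow : ∀ t, μ.real (Iio t) ≤ V t := fun t => by
    rw [hIio]
    exact ENNReal.toReal_mono (hle inter_subset_left)
      (eVariationOn.mono γ (inter_subset_inter_right _ Iio_subset_Iic_self))
  have hup : ∀ t, V t ≤ μ.real (Iic t) := fun t => by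
    have hI := tendsto_measure_biInter_gt (μ := μ) (s := fun s : ℝ => Iio s) (a := t)
      (fun _ _ => measurableSet_Iio.nullMeasurableSet) (fun _ _ _ hij => Iio_subset_Iio hij)
      ⟨t + 1, by simp, measure_ne_top _ _⟩
    have hset : ⋂ r > t, Iio r = Iic t := by
      ext x
      simp only [mem_iInter, mem_Iic, mem_Iio]
      exact ⟨fun hx => le_of_forall_gt_imp_ge_of_dense fun r hr => (hx r hr).le,
        fun hx r hr => hx.trans_lt hr⟩
    rw [hset] at hI
    refine ge_of_tendsto ((ENNReal.tendsto_toReal (measure_ne_top _ _)).comp hI) ?_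
    filter_upwards [self_mem_nhdsWithin] with s hs
    refine le_of_le_of_eq ?_ (hIio s).symm
    exact ENNReal.toReal_mono (hle inter_subset_left)
      (eVariationOn.mono γ (inter_subset_inter_right _ (Iic_subset_Iio.2 hs)))
  choose N u hu humem hsum using fun k : ℕ =>
    exists_eVariationOn_le_sum_add hne hfin (ε := 1 / ((k : ℝ) + 1)) (by positivity)
  set f : ℕ → ℝ → ℝ := fun k => inscribedLength γ (u k) (N k)
  have hmono : ∀ k, Monotone fun s => V s - f k s := fun k s t hst => by
    have := inscribedLength_sub_le hVmono hdist (hu k) (humem k) (N k) hst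
    simp only [f]
    linarith
  have hinc : ∀ k x y, (V y - f k y) - (V x - f k x) ≤ 1 / ((k : ℝ) + 1) := by
    intro k x y
    have h1 : V y - f k y ≤ V (max y (u k (N k))) - f k (max y (u k (N k))) :=
      hmono k (le_max_left _ _)
    have h2 : V (min x (u k 0)) - f k (min x (u k 0)) ≤ V x - f k x := hmono k (min_le_left _ _)
    have h3 : f k (max y (u k (N k))) = _ := inscribedLength_of_ge (hu k) (le_max_right _ _)
    have h4 : f k (min x (u k 0)) = 0 := inscribedLength_of_le (hu k) (min_le_right _ _)
    have h5 : 0 ≤ V (min x (u k 0)) := ENNReal.toReal_nonneg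
    linarith [hVle (max y (u k (N k))), hsum k]
  have hvert : ∀ᵐ t : ℝ, ∀ k i, t ≠ u k i :=
    ae_all_iff.2 fun k => ae_all_iff.2 fun i => Measure.ae_ne volume _
  filter_upwards [hVmono.ae_hasDerivAt_rnDeriv_of_measure_le hlow hup, hvert,
    ae_exists_hasDerivAt_lt_of_increments_tendsto_zero hmono
      tendsto_one_div_add_atTop_nhds_zero_nat hinc] with t hVt htu hsmall ht
  refine tendsto_dist_div_of_hasDerivAt hVt ?_ hVmono fun η hη => ?_
  · filter_upwards [isOpen_Ioo.mem_nhds ht] with s hs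
    rcases le_total s t with h | h
    · rw [abs_sub_comm]
      exact (hdist s hs t ht h).trans (le_abs_self _)
    · rw [dist_comm]
      exact (hdist t ht s hs h).trans (le_abs_self _)
  · obtain ⟨k, w, hw, hd⟩ := hsmall η hη
    refine ⟨f k, _, sub_lt_sub_left hw _, ?_, eventually_abs_inscribedLength_sub_le (hu k) (N k)
      (htu k)⟩
    simpa [Pi.sub_def] using hVt.sub hd

end Variation

namespace IsSpeedMeasure

variable {X : Type*} [MetricSpace X] {γ : ℝ → X} {I : Set ℝ} {ν : Measure ℝ}

theorem sigmaFinite (hν : IsSpeedMeasure γ I ν) (hI : I.OrdConnected)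
    (hγ : ∀ a ∈ I, ∀ b ∈ I, a ≤ b → eVariationOn γ (Icc a b) < ⊤) : SigmaFinite ν := by
  have hloc : ∀ t ∈ I, ∃ U : Set ℝ, IsOpen U ∧ t ∈ U ∧ ν (U ∩ I) < ⊤ := by
    intro t ht
    obtain ⟨L, a, hLo, hLc, htL, ha, hat, hLa⟩ : ∃ (L : Set ℝ) (a : ℝ), IsOpen L ∧
        L.OrdConnected ∧ t ∈ L ∧ a ∈ I ∧ a ≤ t ∧ L ∩ I ⊆ Ici a := by
      by_cases h : ∃ a ∈ I, a < t
      · obtain ⟨a, ha, hat⟩ := h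
        exact ⟨Ioi a, a, isOpen_Ioi, ordConnected_Ioi, hat, ha, hat.le,
          inter_subset_left.trans Ioi_subset_Ici_self⟩
      · push Not at h
        exact ⟨univ, t, isOpen_univ, ordConnected_univ, mem_univ t, ht, le_rfl,
          fun x hx => h x hx.2⟩
    obtain ⟨R, b, hRo, hRc, htR, hb, htb, hRb⟩ : ∃ (R : Set ℝ) (b : ℝ), IsOpen R ∧
        R.OrdConnected ∧ t ∈ R ∧ b ∈ I ∧ t ≤ b ∧ R ∩ I ⊆ Iic b := by
      by_cases h : ∃ b ∈ I, t < b
      · obtain ⟨b, hb, htb⟩ := h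
        exact ⟨Iio b, b, isOpen_Iio, ordConnected_Iio, htb, hb, htb.le,
          inter_subset_left.trans Iio_subset_Iic_self⟩
      · push Not at h
        exact ⟨univ, t, isOpen_univ, ordConnected_univ, mem_univ t, ht, le_rfl,
          fun x hx => h x hx.2⟩
    refine ⟨L ∩ R, hLo.inter hRo, ⟨htL, htR⟩, ?_⟩
    rw [hν.2 _ inter_subset_right ((hLc.inter hRc).inter hI) ⟨_, hLo.inter hRo, rfl⟩]
    refine (eVariationOn.mono γ ?_).trans_lt (hγ a ha b hb (hat.trans htb))
    exact fun x hx => ⟨hLa ⟨hx.1.1, hx.2⟩, hRb ⟨hx.1.2, hx.2⟩⟩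
  choose! U hUo htU hUfin using hloc
  obtain ⟨T, hTI, hTc, hT⟩ := TopologicalSpace.countable_cover_nhdsWithin
    (f := U) (s := I) fun t ht => mem_nhdsWithin_of_mem_nhds ((hUo t ht).mem_nhds (htU t ht))
  refine Measure.sigmaFinite_of_countable (S := insert Iᶜ ((fun t => U t ∩ I) '' T))
    ((hTc.image _).insert _) ?_ (eq_univ_of_forall fun x => ?_)
  · rintro _ (rfl | ⟨t, ht, rfl⟩)
    exacts [by simp [hν.1], hUfin t (hTI ht)]
  · by_cases hx : x ∈ I
    · obtain ⟨t, ht, hxt⟩ := mem_iUnion₂.1 (hT hx)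
      exact ⟨_, mem_insert_of_mem _ (mem_image_of_mem _ ht), hxt, hx⟩
    · exact ⟨_, mem_insert _ _, hx⟩

theorem ae_tendsto_dist_div (hν : IsSpeedMeasure γ I ν) (hI : I.OrdConnected)
    (hγ : ∀ a ∈ I, ∀ b ∈ I, a ≤ b → eVariationOn γ (Icc a b) < ⊤) :
    ∀ᵐ t, t ∈ I → Tendsto (fun s => dist (γ s) (γ t) / |s - t|) (𝓝[≠] t)
      (𝓝 (ν.rnDeriv volume t).toReal) := by
  have := hν.sigmaFinite hI hγ
  have hq : ∀ᵐ t : ℝ, ∀ p q : ℚ, (p : ℝ) ∈ I → (q : ℝ) ∈ I → t ∈ Ioo (p : ℝ) q →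
      Tendsto (fun s => dist (γ s) (γ t) / |s - t|) (𝓝[≠] t)
        (𝓝 (ν.rnDeriv volume t).toReal) := by
    refine ae_all_iff.2 fun p => ae_all_iff.2 fun q => ?_
    by_cases hpq : (p : ℝ) ∈ I ∧ (q : ℝ) ∈ I ∧ (p : ℝ) ≤ q
    · obtain ⟨hp, hq, hle⟩ := hpq
      have hsub : Ioo (p : ℝ) q ⊆ I := Ioo_subset_Icc_self.trans (hI.out hp hq)
      have hloc := ae_tendsto_dist_div_of_mem_Ioo (γ := γ) (ν := ν)
        ((eVariationOn.mono γ Ioo_subset_Icc_self).trans_lt (hγ p hp q hq hle)).ne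
        fun J hJ hJc hJo => hν.2 J (hJ.trans hsub) hJc
          ⟨J, hJo, (inter_eq_left.2 (hJ.trans hsub)).symm⟩
      filter_upwards [hloc, Measure.rnDeriv_restrict ν volume (measurableSet_Ioo (a := (p : ℝ))
        (b := q))] with t ht hrn _ _ htpq
      have h := ht htpq
      rwa [hrn, indicator_of_mem htpq] at h
    · exact Eventually.of_forall fun t hp hq ht =>
        absurd ⟨hp, hq, (ht.1.trans ht.2).le⟩ hpq
  have hfr : ∀ᵐ t : ℝ, t ∉ frontier I :=
    measure_eq_zero_iff_ae_notMem.1 (hI.convex.addHaar_frontier volume)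
  filter_upwards [hq, hfr] with t ht htf htI
  have hint : I ∈ 𝓝 t := by
    rw [mem_nhds_iff, ← mem_interior]
    by_contra h
    exact htf ⟨subset_closure htI, h⟩
  obtain ⟨l, r, hlr, hsub⟩ := mem_nhds_iff_exists_Ioo_subset.1 hint
  obtain ⟨p, hp⟩ := exists_rat_btwn hlr.1
  obtain ⟨q, hq⟩ := exists_rat_btwn hlr.2
  exact ht p q (hsub ⟨hp.1, hp.2.trans hlr.2⟩) (hsub ⟨hlr.1.trans hq.1, hq.2⟩) ⟨hp.2, hq.1⟩

end IsSpeedMeasure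

/-- If `ν = ν_ac + ν_sing` is the Lebesgue decomposition of the speed
measure of `γ ∈ BV_loc(I;X)` with respect to Lebesgue measure, then the metric
derivative `|γ̇|` exists a.e. on `I` and is a Radon–Nikodým derivative of `ν_ac`,
i.e. `ν_ac = |γ̇| ⋅ λ` (on `I`). -/
theorem metric_derivative_is_RN_derivative {X : Type*} [MetricSpace X]
    (I : Set ℝ) (hI : I.OrdConnected) (γ : ℝ → X)
    (hγ : ∀ a ∈ I, ∀ b ∈ I, a ≤ b → eVariationOn γ (Set.Icc a b) < ⊤)
    (ν νac νsing : Measure ℝ) (hν : IsSpeedMeasure γ I ν)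
    (hdecomp : ν = νac + νsing)
    (hac : νac ≪ volume) (hsing : νsing ⟂ₘ volume) :
    ∃ D : ℝ → ℝ, Measurable D ∧
      (∀ᵐ t ∂(volume.restrict I),
        Tendsto (fun s => dist (γ s) (γ t) / |s - t|) (𝓝[I \ {t}] t) (𝓝 (D t))) ∧
      νac = volume.withDensity (I.indicator fun t => ENNReal.ofReal (D t)) := by
  have := hν.sigmaFinite hI hγ
  have : SigmaFinite νac := Measure.sigmaFinite_of_le ν (hdecomp ▸ Measure.le_add_right le_rfl)
  have hrestrict : ν.restrict I = ν :=
    Measure.restrict_eq_self_of_ae_mem (mem_ae_iff.2 hν.1)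
  have hindicator : ν.rnDeriv volume =ᵐ[volume] I.indicator (ν.rnDeriv volume) := by
    have h := Measure.rnDeriv_restrict ν volume hI.measurableSet
    rwa [hrestrict] at h
  have hacν : νac.rnDeriv volume =ᵐ[volume] ν.rnDeriv volume :=
    Measure.eq_rnDeriv (Measure.measurable_rnDeriv _ _) hsing <| by
      rw [Measure.withDensity_rnDeriv_eq _ _ hac, hdecomp, add_comm]
  refine ⟨fun t => (ν.rnDeriv volume t).toReal, (Measure.measurable_rnDeriv _ _).ennreal_toReal,
    ?_, ?_⟩
  · rw [ae_restrict_iff' hI.measurableSet]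
    filter_upwards [hν.ae_tendsto_dist_div hI hγ] with t ht htI
    exact (ht htI).mono_left (nhdsWithin_mono _ fun s hs => hs.2)
  · rw [← Measure.withDensity_rnDeriv_eq _ _ hac]
    refine withDensity_congr_ae ?_
    filter_upwards [hacν, hindicator, Measure.rnDeriv_lt_top ν volume] with t h1 h2 h3
    rw [h1, h2]
    by_cases ht : t ∈ I
    · simp [ht, ENNReal.ofReal_toReal h3.ne]
    · simp [ht]
end

section
/- Let γ : I → X be locally of bounded variation, fix c ∈ I, let V_γ(t) denote the signed variation (V_γ(t) = Var(γ;[c,t]) for t ≥ c, V_γ(t) = −Var(γ;[t,c]) for t ≤ c), and let v be its right-continuous modification v(t) = V_γ(t+). Then for λ-almost every t ∈ I, v is differentiable at t, the metric derivative |γ̇|(t) exists, and v'(t) = |γ̇|(t). -/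
open Filter Topology Set MeasureTheory

/-- If nonnegative functions `g n`, monotone on `[a, b]`, have summable values at `b`, then their
derivatives tend to zero almost everywhere. -/
theorem ae_tendsto_deriv_zero_of_summable_monotoneOn {a b : ℝ} {g : ℕ → ℝ → ℝ}
    (hg : ∀ n, MonotoneOn (g n) (Icc a b)) (hg0 : ∀ n, ∀ t ∈ Icc a b, 0 ≤ g n t)
    (hsum : Summable fun n => g n b) :
    ∀ᵐ t, t ∈ Ioo a b →
      (∀ n, DifferentiableAt ℝ (g n) t) ∧ Tendsto (fun n => deriv (g n) t) atTop (𝓝 0) := by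
  have hsummable : ∀ t ∈ Icc a b, Summable fun n => g n t := fun t ht =>
    Summable.of_nonneg_of_le (fun n => hg0 n t ht)
      (fun n => hg n ht (right_mem_Icc.2 (ht.1.trans ht.2)) ht.2) hsum
  have htail : ∀ N, MonotoneOn (fun t => (∑' n, g n t) - ∑ n ∈ Finset.range N, g n t)
      (Icc a b) := by
    intro N s hs t ht hst
    have hs' := (hsummable s hs).sum_add_tsum_nat_add N
    have ht' := (hsummable t ht).sum_add_tsum_nat_add N
    have : ∑' n, g (n + N) s ≤ ∑' n, g (n + N) t :=
      Summable.tsum_le_tsum (fun n => hg _ hs ht hst)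
        ((summable_nat_add_iff N).2 (hsummable s hs))
        ((summable_nat_add_iff N).2 (hsummable t ht))
    simp only
    linarith
  have hmono : MonotoneOn (fun t => ∑' n, g n t) (Icc a b) := by simpa using htail 0
  have hdiff : ∀ᵐ t, ∀ n, t ∈ Icc a b → DifferentiableWithinAt ℝ (g n) (Icc a b) t :=
    ae_all_iff.2 fun n => (hg n).ae_differentiableWithinAt_of_mem
  filter_upwards [hdiff, hmono.ae_differentiableWithinAt_of_mem] with t h1 h2 ht
  have hnhds : Icc a b ∈ 𝓝 t := Icc_mem_nhds ht.1 ht.2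
  have ht' := Ioo_subset_Icc_self ht
  have hd : ∀ n, DifferentiableAt ℝ (g n) t := fun n => (h1 n ht').differentiableAt hnhds
  have hG := (h2 ht').differentiableAt hnhds
  refine ⟨hd, ?_⟩
  have hnonneg : ∀ {f : ℝ → ℝ}, MonotoneOn f (Icc a b) → 0 ≤ deriv f t := fun {f} hf => by
    rw [← derivWithin_of_mem_nhds hnhds]
    exact hf.derivWithin_nonneg
  refine (summable_of_sum_range_le (c := deriv (fun t => ∑' n, g n t) t)
    (fun n => hnonneg (hg n)) fun N => ?_).tendsto_atTop_zero
  have h := hnonneg (htail N)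
  have hd' : HasDerivAt (fun t => (∑' n, g n t) - ∑ n ∈ Finset.range N, g n t)
      (deriv (fun t => ∑' n, g n t) t - ∑ n ∈ Finset.range N, deriv (g n) t) t :=
    hG.hasDerivAt.fun_sub (HasDerivAt.fun_sum fun n _ => (hd n).hasDerivAt)
  rw [hd'.deriv] at h
  linarith

namespace eVariationOn

variable {X : Type*} [PseudoMetricSpace X]

theorem insert_inter_Iic_le_add (γ : ℝ → X) (P : Set ℝ) {s t : ℝ} (hst : s ≤ t) :
    eVariationOn γ (insert t (P ∩ Iic t)) ≤
      eVariationOn γ (insert s (P ∩ Iic s)) +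
        eVariationOn γ (insert s (insert t (P ∩ Icc s t))) := by
  rw [← eVariationOn.union γ (x := s)]
  · refine eVariationOn.mono γ ?_
    rintro x (rfl | ⟨hx, hxt⟩)
    · simp
    · rcases le_total x s with h | h
      · exact Or.inl (Or.inr ⟨hx, h⟩)
      · exact Or.inr (Or.inr (Or.inr ⟨hx, h, hxt⟩))
  · refine ⟨mem_insert _ _, ?_⟩
    rintro x (rfl | ⟨-, hx⟩)
    exacts [le_rfl, hx]
  · refine ⟨mem_insert _ _, ?_⟩
    rintro x (rfl | rfl | ⟨-, hx⟩)
    exacts [le_rfl, hst, hx.1]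

/-- A finite set of points almost realizes the variation. -/
theorem exists_finite_subset_lt {γ : ℝ → X} {S : Set ℝ} {r : ENNReal}
    (h : r < eVariationOn γ S) : ∃ P ⊆ S, P.Finite ∧ r < eVariationOn γ P := by
  obtain ⟨⟨n, u, hu, huS⟩, hr⟩ := lt_iSup_iff.1 h
  refine ⟨u '' Iic n, ?_, (finite_Iic n).image u, hr.trans_le ?_⟩
  · rintro _ ⟨i, -, rfl⟩
    exact huS i
  · exact eVariationOn.sum_le_of_monotoneOn_Iic (hu.monotoneOn _)
      fun i hi => mem_image_of_mem u hi

end eVariationOn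

section

variable {X : Type*} [PseudoMetricSpace X] {γ : ℝ → X} {a b : ℝ}

theorem BoundedVariationOn.toReal_Icc_add_Icc (hγ : BoundedVariationOn γ (Icc a b)) {s t : ℝ}
    (has : a ≤ s) (hst : s ≤ t) (htb : t ≤ b) :
    (eVariationOn γ (Icc a s)).toReal + (eVariationOn γ (Icc s t)).toReal =
      (eVariationOn γ (Icc a t)).toReal := by
  have h := eVariationOn.Icc_add_Icc γ has hst (mem_univ s)
  simp only [univ_inter] at h
  rw [← h, ENNReal.toReal_add]
  · exact hγ.mono (Icc_subset_Icc le_rfl (hst.trans htb))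
  · exact hγ.mono (Icc_subset_Icc has htb)

/-- The variation along a finite set `P`, stopped at `t`, whose defect from the full variation
is monotone in `t`. -/
theorem BoundedVariationOn.exists_monotoneOn_defect (hab : a ≤ b)
    (hγ : BoundedVariationOn γ (Icc a b)) {ε : ℝ} (hε : 0 < ε) :
    ∃ (P : Set ℝ) (f : ℝ → ℝ), P.Finite ∧
      (∀ s ∈ Icc a b, ∀ t ∈ Icc a b, s ≤ t → P ∩ Ioc s t = ∅ →
        f t - f s ≤ dist (γ s) (γ t)) ∧
      MonotoneOn (fun t => (eVariationOn γ (Icc a t)).toReal - f t) (Icc a b) ∧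
      (∀ t ∈ Icc a b, 0 ≤ (eVariationOn γ (Icc a t)).toReal - f t) ∧
      (eVariationOn γ (Icc a b)).toReal - f b ≤ ε := by
  obtain ⟨P, hP, hPfin, hPε⟩ : ∃ P ⊆ Icc a b, P.Finite ∧
      (eVariationOn γ (Icc a b)).toReal - ε ≤ (eVariationOn γ P).toReal := by
    rcases le_or_gt (eVariationOn γ (Icc a b)).toReal ε with h | h
    · exact ⟨∅, empty_subset _, finite_empty, (sub_nonpos.2 h).trans ENNReal.toReal_nonneg⟩
    · obtain ⟨P, hP, hfin, hlt⟩ := eVariationOn.exists_finite_subset_lt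
        (γ := γ) (S := Icc a b)
        (r := ENNReal.ofReal ((eVariationOn γ (Icc a b)).toReal - ε)) (by
          rw [ENNReal.ofReal_lt_iff_lt_toReal (by linarith) hγ]
          linarith)
      refine ⟨P, hP, hfin, ?_⟩
      exact (ENNReal.ofReal_le_iff_le_toReal (hγ.mono hP)).1 hlt.le
  have hsub : ∀ t ∈ Icc a b, insert t (P ∩ Iic t) ⊆ Icc a t := by
    rintro t ht x (rfl | ⟨hx, hxt⟩)
    exacts [⟨ht.1, le_rfl⟩, ⟨(hP hx).1, hxt⟩]
  have hsub' : ∀ t ∈ Icc a b, Icc a t ⊆ Icc a b := fun t ht => Icc_subset_Icc le_rfl ht.2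
  have hfin : ∀ t ∈ Icc a b, eVariationOn γ (insert t (P ∩ Iic t)) ≠ ⊤ := fun t ht =>
    hγ.mono ((hsub t ht).trans (hsub' t ht))
  refine ⟨P, fun t => (eVariationOn γ (insert t (P ∩ Iic t))).toReal, hPfin, ?_, ?_, ?_, ?_⟩
  · intro s hs t ht hst hPst
    have h := eVariationOn.insert_inter_Iic_le_add γ P hst
    have hpair : insert s (insert t (P ∩ Icc s t)) ⊆ {s, t} := by
      rintro x (rfl | rfl | ⟨hx, hxs, hxt⟩)
      · simp
      · simp
      · rcases hxs.eq_or_lt with rfl | hlt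
        · simp
        · exact absurd (show x ∈ P ∩ Ioc s t from ⟨hx, hlt, hxt⟩) (by simp [hPst])
    have h' := h.trans (add_le_add le_rfl (eVariationOn.mono γ hpair))
    rw [eVariationOn.pair] at h'
    have h'' := ENNReal.toReal_mono (ENNReal.add_ne_top.2 ⟨hfin s hs, edist_ne_top _ _⟩) h'
    rw [ENNReal.toReal_add (hfin s hs) (edist_ne_top _ _), ← dist_edist] at h''
    linarith
  · intro s hs t ht hst
    have hst_sub : insert s (insert t (P ∩ Icc s t)) ⊆ Icc s t := by
      rintro x (rfl | rfl | ⟨-, hx⟩)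
      exacts [⟨le_rfl, hst⟩, ⟨hst, le_rfl⟩, hx]
    have h := (eVariationOn.insert_inter_Iic_le_add γ P hst).trans
      (add_le_add le_rfl (eVariationOn.mono γ hst_sub))
    have hne : eVariationOn γ (Icc s t) ≠ ⊤ := hγ.mono (Icc_subset_Icc hs.1 ht.2)
    have h' := ENNReal.toReal_mono (ENNReal.add_ne_top.2 ⟨hfin s hs, hne⟩) h
    rw [ENNReal.toReal_add (hfin s hs) hne] at h'
    have := hγ.toReal_Icc_add_Icc hs.1 hst ht.2
    simp only
    linarith
  · intro t ht
    exact sub_nonneg.2 (ENNReal.toReal_mono (hγ.mono (hsub' t ht))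
      (eVariationOn.mono γ (hsub t ht)))
  · have : (eVariationOn γ P).toReal ≤ (eVariationOn γ (insert b (P ∩ Iic b))).toReal :=
      ENNReal.toReal_mono (hfin b (right_mem_Icc.2 hab))
        (eVariationOn.mono γ fun x hx => Or.inr ⟨hx, (hP hx).2⟩)
    simp only
    linarith

/-- The variation function of a curve of bounded variation is differentiable almost everywhere,
with derivative the metric derivative. -/
theorem BoundedVariationOn.ae_hasDerivAt_metric_derivative (hab : a ≤ b)
    (hγ : BoundedVariationOn γ (Icc a b)) :
    ∀ᵐ t, t ∈ Ioo a b → ∃ L : ℝ,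
      HasDerivAt (fun t => (eVariationOn γ (Icc a t)).toReal) L t ∧
        Tendsto (fun s => dist (γ s) (γ t) / |s - t|) (𝓝[≠] t) (𝓝 L) := by
  set U : ℝ → ℝ := fun t => (eVariationOn γ (Icc a t)).toReal with hU
  have hUdist : ∀ s ∈ Icc a b, ∀ t ∈ Icc a b, s ≤ t → dist (γ s) (γ t) ≤ U t - U s := by
    intro s hs t ht hst
    have h1 := hγ.toReal_Icc_add_Icc hs.1 hst ht.2
    have h2 : dist (γ s) (γ t) ≤ (eVariationOn γ (Icc s t)).toReal :=
      (hγ.mono (Icc_subset_Icc hs.1 ht.2)).dist_le (left_mem_Icc.2 hst) (right_mem_Icc.2 hst)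
    simp only [hU]
    linarith
  have hUmono : MonotoneOn U (Icc a b) := fun s hs t ht hst =>
    sub_nonneg.1 (dist_nonneg.trans (hUdist s hs t ht hst))
  choose P f hPfin hf hmono hnonneg hle using fun n : ℕ =>
    hγ.exists_monotoneOn_defect hab (pow_pos (half_pos one_pos) n : 0 < ((1 : ℝ) / 2) ^ n)
  have hsum : Summable fun n => U b - f n b :=
    Summable.of_nonneg_of_le (fun n => hnonneg n b (right_mem_Icc.2 hab)) hle
      summable_geometric_two
  have hnull : ∀ᵐ t, t ∉ ⋃ n, P n :=
    (countable_iUnion fun n => (hPfin n).countable).ae_notMem volume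
  filter_upwards [hUmono.ae_differentiableWithinAt_of_mem, hnull,
    ae_tendsto_deriv_zero_of_summable_monotoneOn hmono hnonneg hsum] with t hUt htP hd ht
  obtain ⟨hdiff, hlim⟩ := hd ht
  have hIcc : Icc a b ∈ 𝓝 t := Icc_mem_nhds ht.1 ht.2
  have ht' := Ioo_subset_Icc_self ht
  have hUd := ((hUt ht').differentiableAt hIcc).hasDerivAt
  refine ⟨deriv U t, hUd, ?_⟩
  have hne : ∀ᶠ s in 𝓝[≠] t, s ≠ t := self_mem_nhdsWithin
  refine tendsto_order.2 ⟨fun l hl => ?_, fun l hl => ?_⟩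
  · obtain ⟨n, hn⟩ := ((tendsto_order.1 hlim).2 _ (sub_pos.2 hl)).exists
    have hfd : HasDerivAt (f n) (deriv U t - deriv (fun t => U t - f n t) t) t := by
      have hdefect : HasDerivAt (fun t => U t - f n t) (deriv (fun t => U t - f n t) t) t :=
        (hdiff n).hasDerivAt
      simpa only [sub_sub_cancel] using hUd.fun_sub hdefect
    have hn' : deriv (fun t => U t - f n t) t < deriv U t - l := hn
    have hslope := (tendsto_order.1 hfd.tendsto_slope).1 l (by linarith)
    have hPc : (P n)ᶜ ∈ 𝓝 t :=
      (hPfin n).isClosed.isOpen_compl.mem_nhds fun h => htP (mem_iUnion.2 ⟨n, h⟩)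
    obtain ⟨δ, hδ, hball⟩ := Metric.mem_nhds_iff.1 hPc
    filter_upwards [hslope, hne, mem_nhdsWithin_of_mem_nhds hIcc,
      mem_nhdsWithin_of_mem_nhds (Metric.ball_mem_nhds t hδ)] with s hs hst hsI hsδ
    refine hs.trans_le ?_
    have hfree : ∀ x, min s t ≤ x → x ≤ max s t → x ∉ P n := by
      intro x hx1 hx2
      refine hball ?_
      rw [Real.ball_eq_Ioo] at hsδ ⊢
      rcases min_le_iff.1 hx1 with h | h <;> rcases le_max_iff.1 hx2 with h' | h' <;>
        constructor <;> linarith [hsδ.1, hsδ.2]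
    rw [slope_def_field]
    rcases lt_or_gt_of_ne hst with h | h
    · rw [abs_of_neg (sub_neg.2 h), ← neg_div_neg_eq]
      refine div_le_div_of_nonneg_right ?_ (by linarith)
      have := hf n s hsI t ht' h.le (by
        ext x
        simp only [mem_inter_iff, mem_Ioc, mem_empty_iff_false, iff_false]
        exact fun hx => hfree x (min_le_iff.2 (Or.inl hx.2.1.le))
          (le_max_iff.2 (Or.inr hx.2.2)) hx.1)
      linarith
    · rw [abs_of_pos (sub_pos.2 h), dist_comm]
      refine div_le_div_of_nonneg_right ?_ (by linarith)
      exact hf n t ht' s hsI h.le (by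
        ext x
        simp only [mem_inter_iff, mem_Ioc, mem_empty_iff_false, iff_false]
        exact fun hx => hfree x (min_le_iff.2 (Or.inr hx.2.1.le))
          (le_max_iff.2 (Or.inl hx.2.2)) hx.1)
  · filter_upwards [(tendsto_order.1 hUd.tendsto_slope).2 l hl, hne,
      mem_nhdsWithin_of_mem_nhds hIcc] with s hs hst hsI
    refine lt_of_le_of_lt ?_ hs
    rw [slope_def_field]
    rcases lt_or_gt_of_ne hst with h | h
    · rw [abs_of_neg (sub_neg.2 h), ← neg_div_neg_eq (U s - U t)]
      exact div_le_div_of_nonneg_right (by linarith [hUdist s hsI t ht' h.le]) (by linarith)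
    · rw [abs_of_pos (sub_pos.2 h), dist_comm]
      exact div_le_div_of_nonneg_right (hUdist t ht' s hsI h.le) (by linarith)

end

/-- A function given near `t` by the right limits of `V` has the same derivative at `t` as `V`. -/
theorem HasDerivAt.of_tendsto_right {V v : ℝ → ℝ} {L t : ℝ} (hV : HasDerivAt V L t)
    (hv : ∀ᶠ s in 𝓝 t, Tendsto V (𝓝[>] s) (𝓝 (v s))) : HasDerivAt v L t := by
  have hvt : v t = V t := tendsto_nhds_unique hv.self_of_nhds
    (hV.continuousAt.tendsto.mono_left nhdsWithin_le_nhds)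
  rw [hasDerivAt_iff_isLittleO, Asymptotics.isLittleO_iff] at hV ⊢
  intro ε hε
  filter_upwards [(hV hε).eventually_nhds, hv] with s hs hvs
  have hid : Tendsto (fun r : ℝ => r) (𝓝[>] s) (𝓝 s) := tendsto_id.mono_left nhdsWithin_le_nhds
  rw [hvt]
  refine le_of_tendsto_of_tendsto
    (((hvs.sub_const (V t)).sub ((hid.sub_const t).smul_const L)).norm)
    ((hid.sub_const t).norm.const_mul ε) ?_
  exact hs.filter_mono nhdsWithin_le_nhds

/-- Let `γ ∈ BV_loc(I;X)`, `c ∈ I`, let `V` be the signed variation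
function based at `c`, and let `v` be its right-continuous modification
(`v(t) = V(t+)`, with `v(t) = V(t)` when `t = sup I ∈ I`). Then for λ-a.e. `t ∈ I`,
`v` is differentiable at `t` (within `I`), the metric derivative `|γ̇|(t)` exists,
and `v'(t) = |γ̇|(t)`. -/
theorem deriv_of_rc_variation_is_metric_derivative {X : Type*} [MetricSpace X]
    (I : Set ℝ) (hI : I.OrdConnected) (γ : ℝ → X)
    (hγ : ∀ a ∈ I, ∀ b ∈ I, a ≤ b → eVariationOn γ (Set.Icc a b) < ⊤)
    (c : ℝ) (hc : c ∈ I) (V v : ℝ → ℝ)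
    (hV₁ : ∀ t ∈ I, c ≤ t → V t = (eVariationOn γ (Set.Icc c t)).toReal)
    (hV₂ : ∀ t ∈ I, t ≤ c → V t = -(eVariationOn γ (Set.Icc t c)).toReal)
    (hv : ∀ t ∈ I,
      (I ∩ Set.Ioi t ≠ ∅ → Tendsto V (𝓝[I ∩ Set.Ioi t] t) (𝓝 (v t))) ∧
      (I ∩ Set.Ioi t = ∅ → v t = V t)) :
    ∀ᵐ t ∂(volume.restrict I),
      ∃ L : ℝ, HasDerivWithinAt v L I t ∧
        Tendsto (fun s => dist (γ s) (γ t) / |s - t|) (𝓝[I \ {t}] t) (𝓝 L) := by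
  rw [ae_restrict_iff' hI.measurableSet]
  refine ae_of_mem_of_ae_of_mem_inter_Ioo fun a b ha hb hab => ?_
  filter_upwards [BoundedVariationOn.ae_hasDerivAt_metric_derivative hab.le
    (hγ a ha b hb hab.le).ne] with t h ht
  obtain ⟨L, hL, hdist⟩ := h ht.2
  have hsubI : Icc a b ⊆ I := hI.out ha hb
  have hVU : ∀ s ∈ Icc a b, V s = (eVariationOn γ (Icc a s)).toReal + V a := by
    intro s hs
    have hsI := hsubI hs
    have hbv : ∀ x ∈ I, ∀ y ∈ I, x ≤ y → BoundedVariationOn γ (Icc x y) :=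
      fun x hx y hy hxy => (hγ x hx y hy hxy).ne
    rcases le_total c a with hca | hac
    · rw [hV₁ a ha hca, hV₁ s hsI (hca.trans hs.1)]
      linarith [(hbv c hc s hsI (hca.trans hs.1)).toReal_Icc_add_Icc hca hs.1 le_rfl]
    · rcases le_total c s with hcs | hsc
      · rw [hV₂ a ha hac, hV₁ s hsI hcs]
        linarith [(hbv a ha s hsI hs.1).toReal_Icc_add_Icc hac hcs le_rfl]
      · rw [hV₂ a ha hac, hV₂ s hsI hsc]
        linarith [(hbv a ha c hc hac).toReal_Icc_add_Icc hs.1 hsc le_rfl]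
  have hVd : HasDerivAt V L t := by
    refine (hL.add_const (V a)).congr_of_eventuallyEq ?_
    filter_upwards [Icc_mem_nhds ht.2.1 ht.2.2] with s hs using hVU s hs
  refine ⟨L, (hVd.of_tendsto_right ?_).hasDerivWithinAt,
    hdist.mono_left (nhdsWithin_mono _ fun x hx => hx.2)⟩
  filter_upwards [Ioo_mem_nhds ht.2.1 ht.2.2] with s hs
  refine ((hv s (hsubI (Ioo_subset_Icc_self hs))).1
    (Set.Nonempty.ne_empty ⟨b, hb, hs.2⟩)).mono_left ?_
  rw [← nhdsWithin_Ioo_eq_nhdsGT hs.2]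
  exact nhdsWithin_mono _ fun x hx => ⟨hsubI ⟨hs.1.le.trans hx.1.le, hx.2.le⟩, hx.1⟩
end
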